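/- arXiv:2206.02352 — 3 statements merged into one kernel-verified Lean document; each statement's English description precedes it below -/
import Mathlib

section
/- Let M be a finitely generated 𝓡-module with pd_𝓡(M) ≤ 1 such that N = E¹(M) = Ext¹_𝓡(M, 𝓡) is pseudo-null and such that M has generic rank one over 𝓡 (i.e., M ⊗_𝓡 Q(𝓡) is a free Q(𝓡)-module of rank one). Then pd_𝓡(N) ≤ 2. -/
noncomputable section

/-- The duality hypothesis: `Hom_Λ(𝓡, Λ) ≅ 𝓡` as `𝓡`-modules, where the `𝓡`-module
structure on `Hom_Λ(𝓡, Λ)` is `(r • φ)(x) = φ (r * x)`. -/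
def SelfDualAlgebra (Λ 𝓡 : Type) [CommRing Λ] [CommRing 𝓡] [Algebra Λ 𝓡] : Prop :=
  ∃ e : (𝓡 →ₗ[Λ] Λ) ≃ₗ[Λ] 𝓡,
    ∀ (r : 𝓡) (φ : 𝓡 →ₗ[Λ] Λ),
      e (φ.comp (LinearMap.mulLeft Λ r)) = r * e φ

/-- `Λ` is a regular local ring: its maximal ideal is generated by `dim Λ` elements. -/
def IsRegularLocal (Λ : Type) [CommRing Λ] [IsLocalRing Λ] : Prop :=
  ∃ s : Finset Λ, Ideal.span (s : Set Λ) = IsLocalRing.maximalIdeal Λ ∧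
    (s.card : WithBot (WithTop ℕ)) = ringKrullDim Λ

/-- A prime ideal `q` has height at most one: there is no chain of primes
`q₀ < q₁ < q`. -/
def HeightLEOne (Λ : Type) [CommRing Λ] (q : Ideal Λ) : Prop :=
  ¬ ∃ q₀ q₁ : Ideal Λ, q₀.IsPrime ∧ q₁.IsPrime ∧ q₀ < q₁ ∧ q₁ < q

/-- An `𝓡`-module `N` is pseudo-null over `Λ`: for every prime `q` of `Λ` of height at
most one, the localization `N_q` vanishes, i.e. every element of `N` is annihilated by
some `s ∉ q`. -/
def IsPseudoNull (Λ : Type) [CommRing Λ] {𝓡 : Type} [CommRing 𝓡] [Algebra Λ 𝓡]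
    (N : Type) [AddCommGroup N] [Module 𝓡 N] : Prop :=
  ∀ q : Ideal Λ, q.IsPrime → HeightLEOne Λ q →
    ∀ x : N, ∃ s : Λ, s ∉ q ∧ algebraMap Λ 𝓡 s • x = 0

/-- A finitely generated module has projective dimension at most one: some (equivalently,
any) surjection from a finite free module has projective kernel. -/
def ProjDimLEOne (𝓡 : Type) [CommRing 𝓡] (M : Type) [AddCommGroup M] [Module 𝓡 M] :
    Prop :=
  ∃ (n : ℕ) (φ : (Fin n → 𝓡) →ₗ[𝓡] M),
    Function.Surjective φ ∧ Module.Projective 𝓡 (LinearMap.ker φ)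

abbrev ExtGrp (R : Type) [CommRing R] (M : Type) [AddCommGroup M] [Module R M] (i : ℕ) :
    ModuleCat R :=
  ((_root_.Ext R (ModuleCat R) i).obj (Opposite.op (ModuleCat.of R M))).obj (ModuleCat.of R R)

/-- `M` has generic rank one over `𝓡`: `M ⊗_𝓡 Q(𝓡)` is a free module of rank one over
the total ring of fractions `Q(𝓡)`. -/
def GenericRankOne (𝓡 : Type) [CommRing 𝓡] (M : Type) [AddCommGroup M] [Module 𝓡 M] :
    Prop :=
  Nonempty (LocalizedModule (nonZeroDivisors 𝓡) M ≃ₗ[Localization (nonZeroDivisors 𝓡)]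
    Localization (nonZeroDivisors 𝓡))

/-- A module has projective dimension at most two: there is a length-two resolution by a
finite free module, a finite free module, and a projective module. -/
def ProjDimLETwo (𝓡 : Type) [CommRing 𝓡] (N : Type) [AddCommGroup N] [Module 𝓡 N] :
    Prop :=
  ∃ (n₀ : ℕ) (φ₀ : (Fin n₀ → 𝓡) →ₗ[𝓡] N), Function.Surjective φ₀ ∧
    ∃ (n₁ : ℕ) (φ₁ : (Fin n₁ → 𝓡) →ₗ[𝓡] LinearMap.ker φ₀), Function.Surjective φ₁ ∧
      Module.Projective 𝓡 (LinearMap.ker φ₁)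

section RegularLocal

open IsLocalRing

theorem exists_isPrime_mem_iff_dvd_mul {A : Type*} [CommRing A] [IsNoetherianRing A] {a u : A}
    (h : ¬ a ∣ u) :
    ∃ (p : Ideal A) (f : A), p.IsPrime ∧ (∀ r, r ∈ p ↔ a ∣ r * f) ∧ ∀ r, a ∣ r * u → r ∈ p := by
  have hu : Ideal.Quotient.mk (Ideal.span {a}) u ≠ 0 := by
    rwa [Ne, Ideal.Quotient.eq_zero_iff_mem, Ideal.mem_span_singleton]
  obtain ⟨p, hp, hle⟩ := exists_le_isAssociatedPrime_of_isNoetherianRing A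
    (M := A ⧸ Ideal.span {a}) _ hu
  have key (r x : A) : r • Ideal.Quotient.mk (Ideal.span {a}) x = 0 ↔ a ∣ r * x := by
    rw [← Ideal.mem_span_singleton, ← Ideal.Quotient.eq_zero_iff_mem]
    rfl
  obtain ⟨hprime, y, hy⟩ := isAssociatedPrime_iff.mp hp
  obtain ⟨f, rfl⟩ := Ideal.Quotient.mk_surjective y
  refine ⟨p, f, hprime, fun r => ?_, fun r hr => hle ?_⟩
  · rw [hy, ← key, Submodule.mem_colon_singleton, Submodule.mem_bot]
  · rwa [Submodule.mem_colon_singleton, Submodule.mem_bot, key]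

theorem mem_iff_dvd_mul_of_dvd_mul {A : Type*} [CommRing A] [IsDomain A] {p : Ideal A} {a f : A}
    (hp : ∀ r, r ∈ p ↔ a ∣ r * f) (ha : a ≠ 0) {b : A} (hb0 : b ≠ 0) (hb : b ∈ p) :
    ∃ g, ∀ r, r ∈ p ↔ b ∣ r * g := by
  obtain ⟨g, hg⟩ := (hp b).1 hb
  refine ⟨g, fun r => ?_⟩
  rw [hp, ← mul_dvd_mul_iff_left hb0, ← mul_dvd_mul_iff_left ha (a := a) (b := b),
    show b * (r * f) = a * (r * g) by linear_combination r * hg, mul_comm b a]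

theorem eq_bot_of_le_span_singleton {A : Type*} [CommRing A] [IsLocalRing A] [IsNoetherianRing A]
    {x : A} (hx : x ∈ maximalIdeal A) {q : Ideal A} [q.IsPrime] (hq : q ≤ Ideal.span {x})
    (hxq : x ∉ q) : q = ⊥ := by
  refine Submodule.eq_bot_of_le_smul_of_le_jacobson_bot (maximalIdeal A) q
    (IsNoetherian.noetherian q) (fun u hu => ?_) (maximalIdeal_le_jacobson _)
  obtain ⟨v, rfl⟩ := Ideal.mem_span_singleton.1 (hq hu)
  exact Submodule.smul_mem_smul hx ((‹q.IsPrime›.mem_or_mem hu).resolve_left hxq)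

theorem exists_maximalIdeal_eq_span_insert {A : Type*} [CommRing A] [IsLocalRing A]
    {s : Finset A} (hs : Ideal.span (s : Set A) = maximalIdeal A) {x : A}
    (hx : x ∈ maximalIdeal A) (hx2 : x ∉ maximalIdeal A ^ 2) :
    ∃ y ∈ s, maximalIdeal A = Ideal.span (insert x ((s : Set A) \ {y})) := by
  classical
  obtain ⟨c, hc⟩ := (Submodule.mem_span_finset'.1 (hs ▸ hx : x ∈ Ideal.span (s : Set A)))
  obtain ⟨y, hy⟩ : ∃ y, c y ∉ maximalIdeal A := by
    by_contra! h
    refine hx2 (hc ▸ sum_mem fun y _ => ?_)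
    rw [pow_two]
    exact Ideal.mul_mem_mul (h y) (hs ▸ Ideal.subset_span y.2)
  refine ⟨y, y.2, le_antisymm ?_ ?_⟩
  · rw [← hs, Ideal.span_le]
    intro z hz
    by_cases hzy : z = y
    · subst hzy
      have hu : IsUnit (c y) := by simpa using hy
      have : c y * (y : A) ∈ Ideal.span (insert x ((s : Set A) \ {(y : A)})) := by
        have h2 : c y * (y : A) = x - ∑ i ∈ Finset.univ.erase y, c i * (i : A) := by
          rw [← hc, ← Finset.add_sum_erase _ _ (Finset.mem_univ y)]
          simp
        rw [h2]
        refine sub_mem (Ideal.subset_span (by simp)) (sum_mem fun i hi => ?_)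
        refine Ideal.mul_mem_left _ _ (Ideal.subset_span ?_)
        have := Finset.ne_of_mem_erase hi
        simp [this]
      exact (Ideal.unit_mul_mem_iff_mem _ hu).1 this
    · exact Ideal.subset_span (by simp [hzy, Finset.mem_coe.1 hz])
  · rw [Ideal.span_le]
    rintro z (rfl | hz)
    · exact hx
    · exact hs ▸ Ideal.subset_span hz.1

theorem exists_mem_maximalIdeal_notMem_minimalPrimes {A : Type*} [CommRing A] [IsLocalRing A]
    [IsNoetherianRing A] (h : ringKrullDim A ≠ 0) :
    ∃ x ∈ maximalIdeal A, x ∉ maximalIdeal A ^ 2 ∧ ∀ q ∈ minimalPrimes A, x ∉ q := by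
  by_contra! H
  have hfin := (minimalPrimes.finite_of_isNoetherianRing A)
  have hsub : (maximalIdeal A : Set A) ⊆
      ⋃ i ∈ insert (maximalIdeal A ^ 2) (minimalPrimes A), ((i : Ideal A) : Set A) := by
    intro x hx
    by_cases hx2 : x ∈ maximalIdeal A ^ 2
    · exact Set.mem_biUnion (Set.mem_insert _ _) hx2
    · obtain ⟨q, hq, hxq⟩ := H x hx hx2
      exact Set.mem_biUnion (Set.mem_insert_of_mem _ hq) hxq
  have hmin : maximalIdeal A ∉ minimalPrimes A := by
    intro hm
    apply h
    rw [← maximalIdeal_height_eq_ringKrullDim, Ideal.height_eq_zero_iff.2 hm]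
    rfl
  have hprime : ∀ i ∈ insert (maximalIdeal A ^ 2) (minimalPrimes A), i ≠ maximalIdeal A ^ 2 →
      i ≠ maximalIdeal A ^ 2 → i.IsPrime := by
    rintro i (rfl | hi) h1 _
    · exact absurd rfl h1
    · exact hi.1.1
  obtain ⟨q, rfl | hq, hle⟩ := (Ideal.subset_union_prime_finite (f := fun i => i)
    (hfin.insert _) _ _ hprime).1 hsub
  · have hbot : maximalIdeal A = ⊥ :=
      Submodule.eq_bot_of_le_smul_of_le_jacobson_bot (maximalIdeal A) _
        (IsNoetherian.noetherian _) (by simpa [pow_two] using hle) (maximalIdeal_le_jacobson _)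
    exact hmin ⟨⟨inferInstance, bot_le⟩, fun q _ _ => hbot ▸ bot_le⟩
  · have := hq.1.1
    exact hmin ((maximalIdeal.isMaximal A).eq_of_le this.ne_top hle ▸ hq)

theorem height_le_one_of_quotient {A : Type*} [CommRing A] [IsLocalRing A] [IsNoetherianRing A]
    [IsDomain A] {x : A} (hx : Prime x)
    (IH : ∀ a : A ⧸ Ideal.span {x}, a ≠ 0 → ∀ (f) (p : Ideal (A ⧸ Ideal.span {x})), p.IsPrime →
      (∀ r, r ∈ p ↔ a ∣ r * f) → p.height ≤ 1)
    {a f : A} (ha : a ≠ 0) {p : Ideal A} (hpp : p.IsPrime) (hp : ∀ r, r ∈ p ↔ a ∣ r * f) :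
    p.height ≤ 1 := by
  have hxm : x ∈ maximalIdeal A := by simpa using hx.not_isUnit
  have hap : a ∈ p := (hp a).2 (dvd_mul_right _ _)
  by_cases hxp : x ∈ p
  · obtain ⟨g, hg⟩ := mem_iff_dvd_mul_of_dvd_mul hp ha hx.ne_zero hxp
    have hxg : ¬ x ∣ g := fun h => hpp.ne_top ((Ideal.eq_top_iff_one p).2 ((hg 1).2 (by simpa)))
    have : p = Ideal.span {x} := by
      refine le_antisymm (fun r hr => ?_) (by simpa [Ideal.span_le])
      exact Ideal.mem_span_singleton.2 ((hx.dvd_or_dvd ((hg r).1 hr)).resolve_right hxg)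
    rw [this]
    exact Ideal.height_span_singleton_le_one hx.not_isUnit
  have hpx : ¬ p ≤ Ideal.span {x} := fun hle =>
    ha (by simpa [eq_bot_of_le_span_singleton hxm hle hxp] using hap)
  obtain ⟨b, hb, hbx⟩ := SetLike.not_le_iff_exists.1 hpx
  rw [Ideal.mem_span_singleton] at hbx
  obtain ⟨g, hg⟩ := mem_iff_dvd_mul_of_dvd_mul hp ha (by rintro rfl; exact hbx (dvd_zero x)) hb
  let U : Ideal A :=
    { carrier := {u | ∀ r ∈ p, b ∣ r * u}
      add_mem' := fun h1 h2 r hr => by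
        rw [mul_add]; exact dvd_add (h1 r hr) (h2 r hr)
      zero_mem' := fun r _ => by simp
      smul_mem' := fun c u hu r hr => by
        rw [smul_eq_mul, mul_left_comm]; exact (hu r hr).mul_left c }
  have hUmem (u : A) : u ∈ U ↔ ∀ r ∈ p, b ∣ r * u := Iff.rfl
  obtain ⟨u, hu, hub⟩ : ∃ u ∈ U, u ∉ Ideal.span {b, x} := by
    by_contra! hU
    have hUb : U ≤ Ideal.span {b} := by
      refine Submodule.le_of_le_smul_of_le_jacobson_bot (I := maximalIdeal A)
        (IsNoetherian.noetherian U) (maximalIdeal_le_jacobson _) fun u hu => ?_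
      obtain ⟨c, h, rfl⟩ := Ideal.mem_span_pair.1 (hU u hu)
      refine Submodule.add_mem_sup (Ideal.mem_span_singleton.2 (dvd_mul_left _ _)) ?_
      rw [mul_comm]
      refine Submodule.smul_mem_smul hxm fun r hr => ?_
      have h1 : b ∣ x * (r * h) := by
        have := (hUmem _).1 hu r hr
        rw [mul_add, ← mul_assoc r c b, dvd_add_right (dvd_mul_left _ _)] at this
        rwa [mul_comm h x, mul_left_comm] at this
      obtain ⟨e, he⟩ := h1
      obtain ⟨e', rfl⟩ := (hx.dvd_or_dvd (Dvd.intro _ he)).resolve_left hbx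
      exact ⟨e', mul_left_cancel₀ hx.ne_zero (by linear_combination he)⟩
    have hgU : g ∈ U := fun r hr => (hg r).1 hr
    exact hpp.ne_top ((Ideal.eq_top_iff_one p).2
      ((hg 1).2 (by simpa using Ideal.mem_span_singleton.1 (hUb hgU))))
  let φ := Ideal.Quotient.mk (Ideal.span {x})
  have hφ (y : A) : φ y = 0 ↔ x ∣ y := by
    rw [Ideal.Quotient.eq_zero_iff_mem, Ideal.mem_span_singleton]
  have hub' : ¬ φ b ∣ φ u := by
    rintro ⟨c, hc⟩
    obtain ⟨c, rfl⟩ := Ideal.Quotient.mk_surjective c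
    rw [← map_mul, ← sub_eq_zero, ← map_sub, hφ] at hc
    obtain ⟨d, hd⟩ := hc
    exact hub (Ideal.mem_span_pair.2 ⟨c, d, by linear_combination -hd⟩)
  obtain ⟨P, f', hP, hPf, hPu⟩ := exists_isPrime_mem_iff_dvd_mul hub'
  have hP1 := IH (φ b) (by rwa [Ne, hφ]) f' P hP hPf
  have hQ : (P.comap φ).IsPrime := hP.comap φ
  have hxQ : x ∈ P.comap φ := by simp [(hφ x).2 dvd_rfl]
  have h2 := Ideal.height_le_height_add_one_of_mem hxQ
  rw [Ideal.map_comap_of_surjective _ Ideal.Quotient.mk_surjective] at h2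
  have hlt : p < P.comap φ := by
    refine lt_of_le_of_ne (fun r hr => hPu _ ?_) (fun h => hxp (h ▸ hxQ))
    rw [← map_mul]
    exact map_dvd φ (hu r hr)
  have h3 := Ideal.height_add_one_le_of_lt_of_isPrime hlt
  have h4 := (h3.trans h2)
  exact ((ENat.add_le_add_iff_right ENat.one_ne_top).1 h4).trans hP1

theorem isDomain_and_height_le_one (d : ℕ) : ∀ (A : Type) [CommRing A] [IsLocalRing A]
    [IsNoetherianRing A] (s : Finset A), s.card ≤ d → Ideal.span (s : Set A) = maximalIdeal A →
    (d : WithBot ℕ∞) ≤ ringKrullDim A →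
    IsDomain A ∧ ∀ a : A, a ≠ 0 → ∀ (f) (p : Ideal A), p.IsPrime →
      (∀ r, r ∈ p ↔ a ∣ r * f) → p.height ≤ 1 := by
  induction d with
  | zero =>
    intro A _ _ _ s hs hspan _
    have hbot : maximalIdeal A = ⊥ := by
      rw [← hspan, Finset.card_eq_zero.1 (Nat.le_zero.1 hs)]
      simp
    have hF : IsField A := isField_iff_maximalIdeal_eq.2 hbot
    let := hF.toField
    refine ⟨hF.isDomain, fun a ha f p hp h => absurd ?_ ha⟩
    have : a ∈ maximalIdeal A := le_maximalIdeal hp.ne_top ((h a).2 (dvd_mul_right _ _))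
    simpa [hbot] using this
  | succ d ih =>
    intro A _ _ _ s hs hspan hdim
    obtain ⟨x, hxm, hx2, hxmin⟩ := exists_mem_maximalIdeal_notMem_minimalPrimes (A := A) (by
      rintro h
      rw [h] at hdim
      norm_cast at hdim)
    obtain ⟨y, hy, hm⟩ := exists_maximalIdeal_eq_span_insert hspan hxm hx2
    have hne : Ideal.span {x} ≠ ⊤ := by
      rwa [Ne, Ideal.span_singleton_eq_top, ← mem_nonunits_iff, ← mem_maximalIdeal]
    have : Nontrivial (A ⧸ Ideal.span {x}) := Ideal.Quotient.nontrivial_iff.2 hne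
    have : IsLocalRing (A ⧸ Ideal.span {x}) :=
      .of_surjective' (Ideal.Quotient.mk _) Ideal.Quotient.mk_surjective
    classical
    obtain ⟨hdom, hB⟩ := ih (A ⧸ Ideal.span {x})
      ((s.erase y).image (Ideal.Quotient.mk (Ideal.span {x})))
      (Finset.card_image_le.trans (by rw [Finset.card_erase_of_mem hy]; omega))
      (by
        rw [← map_maximalIdeal_of_surjective _ (Ideal.Quotient.mk_surjective (I := Ideal.span {x})),
          hm, Ideal.map_span, Set.image_insert_eq, (Ideal.Quotient.eq_zero_iff_mem).2
          (Ideal.mem_span_singleton_self x), Ideal.span_insert_zero]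
        simp)
      (by
        have := hdim.trans (maximalIdeal_height_eq_ringKrullDim.symm.trans_le
          (Ideal.height_le_ringKrullDim_quotient_add_one hxm))
        rw [Nat.cast_succ] at this
        exact ENat.WithBot.add_le_add_one_right_iff.1 this)
    have hxp : (Ideal.span {x}).IsPrime := (Ideal.Quotient.isDomain_iff_prime _).1 hdom
    have hA : IsDomain A := by
      obtain ⟨q, hq, hle⟩ := Ideal.exists_minimalPrimes_le (I := (⊥ : Ideal A))
        (J := Ideal.span {x}) bot_le
      have := hq.1.1
      have hq0 := eq_bot_of_le_span_singleton hxm hle (hxmin q hq)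
      subst hq0
      exact IsDomain.of_bot_isPrime A
    have hx0 : x ≠ 0 := fun h => hx2 (h ▸ zero_mem _)
    exact ⟨hA, fun a ha f p hpp hp => height_le_one_of_quotient
      ((Ideal.span_singleton_prime hx0).1 hxp) hB ha hpp hp⟩

theorem IsRegularLocal.isDomain_and_dvd_of_forall_dvd_mul {A : Type} [CommRing A]
    [IsLocalRing A] [IsNoetherianRing A] (h : IsRegularLocal A) : IsDomain A ∧ ∀ J : Ideal A,
      (∀ q : Ideal A, q.IsPrime → HeightLEOne A q → ¬ J ≤ q) →
      ∀ a f : A, a ≠ 0 → (∀ c ∈ J, a ∣ c * f) → a ∣ f := by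
  obtain ⟨s, hs, hdim⟩ := h
  obtain ⟨hA, hP⟩ := isDomain_and_height_le_one s.card A s le_rfl hs hdim.le
  refine ⟨hA, fun J hJ a f ha hc => ?_⟩
  by_contra haf
  obtain ⟨p, g, hp, hpg, hpf⟩ := exists_isPrime_mem_iff_dvd_mul haf
  refine hJ p hp ?_ fun c hcJ => hpf c (hc c hcJ)
  rintro ⟨q₀, q₁, h₀, h₁, h01, h1p⟩
  have h1 := Ideal.height_add_one_le_of_lt_of_isPrime h01
  have h2 := (Ideal.height_add_one_le_of_lt_of_isPrime h1p).trans (hP a ha g p hp hpg)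
  have h3 : q₁.height ≤ 0 := (ENat.add_le_add_iff_right ENat.one_ne_top).1 (by simpa using h2)
  have := le_add_self.trans (h1.trans h3)
  simp at this

end RegularLocal

namespace Matrix

variable {R : Type*} [CommRing R] {k : ℕ}

/-- The signed maximal minors of a `k × (k + 1)` matrix. -/
def signedMinors (B : Matrix (Fin k) (Fin (k + 1)) R) (i : Fin (k + 1)) : R :=
  (-1) ^ (i : ℕ) * (B.submatrix id i.succAbove).det

theorem det_vecCons_eq_sum_signedMinors (B : Matrix (Fin k) (Fin (k + 1)) R)
    (u : Fin (k + 1) → R) :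
    (of (vecCons u B) : Matrix (Fin (k + 1)) (Fin (k + 1)) R).det = u ⬝ᵥ B.signedMinors := by
  rw [det_succ_row_zero, dotProduct]
  refine Finset.sum_congr rfl fun j _ => ?_
  rw [signedMinors, mul_left_comm, ← mul_assoc]
  rfl

theorem mulVec_signedMinors (B : Matrix (Fin k) (Fin (k + 1)) R) : B *ᵥ B.signedMinors = 0 := by
  ext i
  rw [mulVec, ← det_vecCons_eq_sum_signedMinors]
  exact det_zero_of_row_eq (Fin.succ_ne_zero i).symm rfl

theorem signedMinors_mul_eq_of_mulVec_eq_zero (B : Matrix (Fin k) (Fin (k + 1)) R)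
    {w : Fin (k + 1) → R} (hw : B *ᵥ w = 0) (i j : Fin (k + 1)) :
    B.signedMinors i * w j = B.signedMinors j * w i := by
  set M : Matrix (Fin (k + 1)) (Fin (k + 1)) R := of (vecCons (Pi.single i 1) B) with hM
  have hdet : M.det = B.signedMinors i := by
    rw [hM, det_vecCons_eq_sum_signedMinors, single_one_dotProduct]
  have hMw : M *ᵥ w = Pi.single 0 (w i) := by
    ext l
    refine Fin.cases ?_ (fun l => ?_) l
    · simp [hM, mulVec]
    · exact (congrFun hw l).trans (by simp)
  have hadj : M.adjugate j 0 = B.signedMinors j := by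
    have : M.updateRow 0 (Pi.single j 1) = of (vecCons (Pi.single j 1) B) := by
      ext a b
      refine Fin.cases ?_ (fun a => ?_) a
      · simp
      · rw [updateRow_ne (Fin.succ_ne_zero a)]
        rfl
    rw [adjugate_apply, this, det_vecCons_eq_sum_signedMinors, single_one_dotProduct]
  have := congrFun (congrArg (M.adjugate *ᵥ ·) hMw) j
  simp only [mulVec_mulVec, adjugate_mul, smul_mulVec, one_mulVec, mulVec_single, hdet,
    Pi.smul_apply, smul_eq_mul] at this
  simpa [hadj, mul_comm] using this

theorem det_mul_mem_span_signedMinors (B : Matrix (Fin k) (Fin (k + 1)) R)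
    (C : Matrix (Fin (k + 1)) (Fin k) R) :
    (B * C).det ∈ Ideal.span (Set.range B.signedMinors) := by
  rw [← det_transpose]
  have : (B * C)ᵀ = fun i => ∑ j, C j i • Bᵀ j := by
    ext i l
    simp [mul_apply, Finset.sum_apply, mul_comm]
  rw [this]
  change detRowAlternating _ ∈ _
  rw [← AlternatingMap.coe_multilinearMap, MultilinearMap.map_sum]
  refine sum_mem fun g _ => ?_
  rw [MultilinearMap.map_smul_univ]
  refine Ideal.mul_mem_left _ _ ?_
  by_cases hg : Function.Injective g
  · obtain ⟨i, hi⟩ : ∃ i, i ∉ Set.range g := by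
      by_contra! h
      have := Fintype.card_le_of_surjective g h
      simp at this
    have hex (a : Fin k) : ∃ b, i.succAbove b = g a :=
      Fin.exists_succAbove_eq fun h => hi ⟨a, h⟩
    choose σ hσ using hex
    have hinj : Function.Injective σ := fun a b h => hg (by rw [← hσ, ← hσ, h])
    let e : Equiv.Perm (Fin k) := Equiv.ofBijective σ (Finite.injective_iff_bijective.1 hinj)
    have h1 : (fun a => Bᵀ (g a)) = (B.submatrix id i.succAbove)ᵀ.submatrix e id := by
      ext a b
      simp [e, hσ]
    have h2 : (B.submatrix id i.succAbove).det = (-1) ^ (i : ℕ) * B.signedMinors i := by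
      rw [signedMinors, ← mul_assoc, ← mul_pow]
      simp
    change det (fun a => Bᵀ (g a)) ∈ _
    rw [h1, det_permute, det_transpose, h2]
    exact Ideal.mul_mem_left _ _ (Ideal.mul_mem_left _ _ (Ideal.subset_span ⟨i, rfl⟩))
  · have : (detRowAlternating fun a => Bᵀ (g a)) = 0 := by
      rw [Function.not_injective_iff] at hg
      obtain ⟨a, b, hab, hne⟩ := hg
      exact AlternatingMap.map_eq_zero_of_eq _ _ (by simp [hab]) hne
    simp only [AlternatingMap.coe_multilinearMap, this]
    exact zero_mem _

end Matrix

theorem algebraMap_dvd_of_forall_mul {Λ R : Type*} [CommRing Λ] [CommRing R] [Algebra Λ R]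
    [Module.Free Λ R] {J : Ideal Λ} (hJ : ∀ a f : Λ, a ≠ 0 → (∀ c ∈ J, a ∣ c * f) → a ∣ f)
    {a : Λ} (ha : a ≠ 0) {f : R}
    (h : ∀ c ∈ J, algebraMap Λ R a ∣ algebraMap Λ R c * f) : algebraMap Λ R a ∣ f := by
  let b := Module.Free.chooseBasis Λ R
  have hc (i) : a ∣ b.repr f i := by
    refine hJ a _ ha fun c hc => ?_
    obtain ⟨g, hg⟩ := h c hc
    refine ⟨b.repr g i, ?_⟩
    rw [← Algebra.smul_def, ← Algebra.smul_def] at hg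
    simpa using congrArg (fun x => b.repr x i) hg
  choose g hg using hc
  refine ⟨∑ i ∈ (b.repr f).support, g i • b i, ?_⟩
  rw [← Algebra.smul_def, Finset.smul_sum]
  simp_rw [smul_smul, ← hg]
  exact (b.linearCombination_repr f).symm

/-- If `v` generates an ideal whose contraction to `Λ` has grade at least two, then every vector
proportional to `v` is a multiple of `v`. -/
theorem exists_smul_eq_of_forall_mul_eq {Λ R ι : Type*} [CommRing Λ] [IsDomain Λ] [CommRing R]
    [Algebra Λ R] [Module.Free Λ R] [Finite ι] {v w : ι → R} {J : Ideal Λ}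
    (hJv : J ≤ (Ideal.span (Set.range v)).comap (algebraMap Λ R)) (hJ0 : J ≠ ⊥)
    (hJ : ∀ a f : Λ, a ≠ 0 → (∀ c ∈ J, a ∣ c * f) → a ∣ f)
    (h : ∀ i j, v i * w j = v j * w i) : ∃ s : R, s • v = w := by
  have := Fintype.ofFinite ι
  have hreg {a : Λ} (ha : a ≠ 0) {x y : R} (hxy : algebraMap Λ R a * x = algebraMap Λ R a * y) :
      x = y := by
    rw [← Algebra.smul_def, ← Algebra.smul_def] at hxy
    exact smul_right_injective R ha hxy
  have key (c : Λ) (hc : c ∈ J) : ∃ s : R, ∀ j, algebraMap Λ R c * w j = s * v j := by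
    obtain ⟨d, hd⟩ := (Ideal.mem_span_range_iff_exists_fun).1 (hJv hc)
    refine ⟨∑ i, d i * w i, fun j => ?_⟩
    rw [← hd, Finset.sum_mul, Finset.sum_mul]
    exact Finset.sum_congr rfl fun i _ => by linear_combination d i * h i j
  obtain ⟨a, haJ, ha⟩ := Submodule.exists_mem_ne_zero_of_ne_bot hJ0
  obtain ⟨s, hs⟩ := key a haJ
  obtain ⟨t, rfl⟩ := algebraMap_dvd_of_forall_mul (R := R) hJ ha (f := s) fun c hc => by
    obtain ⟨d, hd⟩ := (Ideal.mem_span_range_iff_exists_fun).1 (hJv hc)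
    refine ⟨∑ i, d i * w i, ?_⟩
    rw [← hd, Finset.sum_mul, Finset.mul_sum]
    exact Finset.sum_congr rfl fun i _ => by linear_combination -d i * hs i
  exact ⟨t, funext fun j => hreg ha (by rw [hs, Pi.smul_apply, smul_eq_mul, mul_assoc])⟩

theorem projective_ker_mulVecLin {Λ R : Type*} [CommRing Λ] [IsDomain Λ] [CommRing R]
    [Algebra Λ R] [Module.Free Λ R] {k : ℕ} (B : Matrix (Fin k) (Fin (k + 1)) R) {J : Ideal Λ}
    (hJv : J ≤ (Ideal.span (Set.range B.signedMinors)).comap (algebraMap Λ R)) (hJ0 : J ≠ ⊥)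
    (hJ : ∀ a f : Λ, a ≠ 0 → (∀ c ∈ J, a ∣ c * f) → a ∣ f) :
    Module.Projective R (LinearMap.ker B.mulVecLin) := by
  let f : R →ₗ[R] LinearMap.ker B.mulVecLin :=
    LinearMap.toSpanSingleton R _ ⟨B.signedMinors, B.mulVec_signedMinors⟩
  refine Module.Projective.of_equiv (LinearEquiv.ofBijective f ⟨?_, ?_⟩)
  · rw [injective_iff_map_eq_zero]
    intro r hr
    have hr (i) : r * B.signedMinors i = 0 := congrFun (congrArg Subtype.val hr) i
    obtain ⟨a, haJ, ha⟩ := Submodule.exists_mem_ne_zero_of_ne_bot hJ0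
    obtain ⟨d, hd⟩ := (Ideal.mem_span_range_iff_exists_fun).1 (hJv haJ)
    have : a • r = 0 := by
      rw [Algebra.smul_def, ← hd, Finset.sum_mul]
      exact Finset.sum_eq_zero fun i _ => by linear_combination d i * hr i
    exact (smul_eq_zero.1 this).resolve_left ha
  · rintro ⟨w, hw⟩
    obtain ⟨s, hs⟩ := exists_smul_eq_of_forall_mul_eq hJv hJ0 hJ
      (B.signedMinors_mul_eq_of_mulVec_eq_zero hw)
    exact ⟨s, Subtype.ext hs⟩

theorem not_comap_span_signedMinors_le {Λ R N : Type*} [CommRing Λ] [CommRing R]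
    [Algebra Λ R] [AddCommGroup N] [Module R N] {k : ℕ} (B : Matrix (Fin k) (Fin (k + 1)) R)
    (f : (Fin k → R) →ₗ[R] N) (hf : LinearMap.ker f ≤ LinearMap.range B.mulVecLin)
    {q : Ideal Λ} [q.IsPrime] (hN : ∀ x : N, ∃ s ∉ q, algebraMap Λ R s • x = 0) :
    ¬ (Ideal.span (Set.range B.signedMinors)).comap (algebraMap Λ R) ≤ q := by
  choose s hsq hs using fun i => hN (f (Pi.single i 1))
  have hprod : ∏ i, s i ∉ q := fun h => by
    obtain ⟨i, -, hi⟩ := Ideal.IsPrime.prod_mem_iff.1 h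
    exact hsq i hi
  have hC (i) : ∃ c, B.mulVec c = algebraMap Λ R (s i) • Pi.single i 1 :=
    hf (by rw [LinearMap.mem_ker, map_smul, hs])
  choose C hC using hC
  have hBC : B * (Matrix.of C).transpose = Matrix.diagonal (fun i => algebraMap Λ R (s i)) := by
    ext i j
    have := congrFun (hC j) i
    simp only [Pi.smul_apply, smul_eq_mul, Pi.single_apply, mul_ite, mul_one, mul_zero] at this
    rw [Matrix.diagonal_apply]
    refine Eq.trans this ?_
    split_ifs with h <;> simp [h]
  intro h
  refine hprod (h ?_)
  have := B.det_mul_mem_span_signedMinors (Matrix.of C).transpose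
  rwa [hBC, Matrix.det_diagonal, ← map_prod] at this

theorem projective_ker_mulVecLin_of_isPseudoNull {Λ R : Type} [CommRing Λ] [IsNoetherianRing Λ]
    [IsLocalRing Λ] (hreg : IsRegularLocal Λ) [CommRing R] [Algebra Λ R] [Module.Free Λ R]
    {N : Type} [AddCommGroup N] [Module R N] (hN : IsPseudoNull Λ (𝓡 := R) N) {k : ℕ}
    (B : Matrix (Fin k) (Fin (k + 1)) R) (f : (Fin k → R) →ₗ[R] N)
    (hf : LinearMap.ker f ≤ LinearMap.range B.mulVecLin) :
    Module.Projective R (LinearMap.ker B.mulVecLin) := by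
  obtain ⟨hΛ, hdvd⟩ := hreg.isDomain_and_dvd_of_forall_dvd_mul
  have hJ (q : Ideal Λ) (hq : q.IsPrime) (hq1 : HeightLEOne Λ q) :=
    not_comap_span_signedMinors_le B f hf (q := q) (hN q hq hq1)
  refine projective_ker_mulVecLin B le_rfl (fun h => hJ ⊥ Ideal.isPrime_bot ?_ h.le)
    (hdvd _ hJ)
  rintro ⟨q₀, q₁, -, -, -, h⟩
  exact not_lt_bot h

theorem finite_maximalSpectrum_of_finite (A R : Type*) [CommRing A] [IsLocalRing A]
    [CommRing R] [Algebra A R] [Module.Finite A R] : Finite (MaximalSpectrum R) := by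
  have hfin := Algebra.QuasiFinite.finite_primesOver (S := R) (IsLocalRing.maximalIdeal A)
  have hint : Algebra.IsIntegral A R := inferInstance
  have := hfin.to_subtype
  refine Finite.of_injective (β := (IsLocalRing.maximalIdeal A).primesOver R)
    (fun m => ⟨m.asIdeal, m.isMaximal.isPrime, ⟨?_⟩⟩) fun m n h =>
      MaximalSpectrum.ext (congrArg Subtype.val h)
  have := m.isMaximal
  exact (IsLocalRing.eq_maximalIdeal (Ideal.isMaximal_comap_of_isIntegral_of_isMaximal
    (R := A) m.asIdeal)).symm

namespace Module

open TensorProduct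

theorem finrank_quotient_tensor_eq_rankAtStalk {R P : Type*} [CommRing R] [AddCommGroup P]
    [Module R P] [Module.Finite R P] [Module.Projective R P] (m : Ideal R) [hm : m.IsMaximal] :
    finrank (R ⧸ m) ((R ⧸ m) ⊗[R] P) = rankAtStalk P ⟨m, hm.isPrime⟩ := by
  let := Ideal.Quotient.field m
  rw [← Ideal.finrank_fiber_eq_rankAtStalk, ← finrank_baseChange (R := m.ResidueField)]
  exact (AlgebraTensorModule.cancelBaseChange R (R ⧸ m) m.ResidueField m.ResidueField P).finrank_eq

theorem nonempty_basis_of_rankAtStalk_eq {R P : Type*} [CommRing R] [Finite (MaximalSpectrum R)]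
    [AddCommGroup P] [Module R P] [Module.Finite R P] [Module.Projective R P] {n : ℕ}
    (h : ∀ p, rankAtStalk (R := R) P p = n) : Nonempty (Basis (Fin n) R P) :=
  nonempty_basis_of_flat_of_finrank_eq R P n fun m => by
    have := m.isMaximal
    rw [finrank_quotient_tensor_eq_rankAtStalk, h]

theorem rankAtStalk_add_one_of_exact {Q A B C : Type*} [CommRing Q] [AddCommGroup A] [Module Q A]
    [Module.Finite Q A] [Module.Projective Q A] [AddCommGroup B] [Module Q B] [AddCommGroup C]
    [Module Q C] {f : A →ₗ[Q] B} {g : B →ₗ[Q] C} (hf : Function.Injective f)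
    (h : Function.Exact f g) (hg : Function.Surjective g) (e : C ≃ₗ[Q] Q) (q : PrimeSpectrum Q) :
    rankAtStalk A q + 1 = rankAtStalk B q := by
  have : Nontrivial Q := q.nontrivial
  have : Module.Projective Q C := .of_equiv e.symm
  obtain ⟨l, hl⟩ := Module.projective_lifting_property g .id hg
  have E := (h.splitSurjectiveEquiv hf ⟨l, hl⟩).1.trans ((LinearEquiv.refl Q A).prodCongr e)
  rw [rankAtStalk_eq_of_equiv E, rankAtStalk_prod, Pi.add_apply, rankAtStalk_self, Pi.one_apply]

theorem exists_rankAtStalk_localization_nonZeroDivisors_eq {R P : Type*} [CommRing R]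
    [AddCommGroup P] [Module R P] [Module.Finite R P] [Module.Projective R P]
    (p : PrimeSpectrum R) : ∃ q, rankAtStalk (R := Localization (nonZeroDivisors R))
      (LocalizedModule (nonZeroDivisors R) P) q = rankAtStalk P p := by
  obtain ⟨q, hq, hle⟩ := Ideal.exists_minimalPrimes_le (I := (⊥ : Ideal R)) (J := p.asIdeal) bot_le
  have hqp : q.IsPrime := hq.1.1
  have hd := Ideal.disjoint_nonZeroDivisors_of_mem_minimalPrimes hq
  let Q := Localization (nonZeroDivisors R)
  have hQ : (q.map (algebraMap R Q)).IsPrime :=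
    IsLocalization.isPrime_of_isPrime_disjoint (nonZeroDivisors R) Q q hqp hd.symm
  have hcomap : (q.map (algebraMap R Q)).comap (algebraMap R Q) = q :=
    IsLocalization.under_map_of_isPrime_disjoint (nonZeroDivisors R) Q hqp hd.symm
  refine ⟨⟨_, hQ⟩, ?_⟩
  rw [← rankAtStalk_eq_of_le_of_finite_of_flat P (p := ⟨q, hqp⟩) (q := p) hle,
    rankAtStalk_isBaseChange (LocalizedModule.isBaseChange (nonZeroDivisors R) P)]
  congr
  exact PrimeSpectrum.ext hcomap

end Module

open Module in
theorem GenericRankOne.rankAtStalk_ker_add_one {R M : Type} [CommRing R] [IsNoetherianRing R]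
    [AddCommGroup M] [Module R M] (h : GenericRankOne R M) {n : ℕ} {φ : (Fin n → R) →ₗ[R] M}
    (hφ : Function.Surjective φ) [Module.Projective R (LinearMap.ker φ)] (p : PrimeSpectrum R) :
    rankAtStalk (LinearMap.ker φ) p + 1 = n := by
  obtain ⟨e⟩ := h
  set S := nonZeroDivisors R
  let Q := Localization S
  have : Nontrivial R := p.nontrivial
  have hex : Function.Exact (LocalizedModule.map S (LinearMap.ker φ).subtype)
      (LocalizedModule.map S φ) :=
    LocalizedModule.map_exact S _ _ (LinearMap.exact_subtype_ker_map φ)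
  obtain ⟨q, hq⟩ := exists_rankAtStalk_localization_nonZeroDivisors_eq (P := LinearMap.ker φ) p
  have hrank := rankAtStalk_add_one_of_exact (Q := Q) (A := LocalizedModule S (LinearMap.ker φ))
    (B := LocalizedModule S (Fin n → R)) (C := LocalizedModule S M)
    (LocalizedModule.map_injective S _ Subtype.val_injective) hex
    (LocalizedModule.map_surjective S φ hφ) e q
  have : Nontrivial Q := q.nontrivial
  rw [← hq, hrank, rankAtStalk_isBaseChange (LocalizedModule.isBaseChange S (Fin n → R)),
    rankAtStalk_eq_finrank_of_free]
  simp

theorem ChainComplex.down_rel_one_zero : (ComplexShape.down ℕ).Rel 1 0 := by simp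

namespace CategoryTheory.ShortComplex.ShortExact

open Limits HomologicalComplex

variable {C : Type*} [Category* C] [Abelian C] {S : ShortComplex C}

theorem double_d_comp_g (S : ShortComplex C) :
    (double S.f ChainComplex.down_rel_one_zero).d 1 0 ≫
      (doubleXIso₁ S.f ChainComplex.down_rel_one_zero one_ne_zero).hom ≫ S.g = 0 := by
  simp [double_d S.f ChainComplex.down_rel_one_zero one_ne_zero]

/-- The projective resolution of length one attached to a short exact sequence whose first two
terms are projective. -/
def projectiveResolution (hS : S.ShortExact) [Projective S.X₁] [Projective S.X₂] :
    ProjectiveResolution S.X₃ where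
  complex := double S.f ChainComplex.down_rel_one_zero
  projective n := by
    by_cases h1 : n = 1
    · subst h1
      exact Projective.of_iso (doubleXIso₀ S.f ChainComplex.down_rel_one_zero).symm inferInstance
    by_cases h0 : n = 0
    · subst h0
      exact Projective.of_iso
        (doubleXIso₁ S.f ChainComplex.down_rel_one_zero one_ne_zero).symm inferInstance
    exact (isZero_double_X S.f ChainComplex.down_rel_one_zero n h1 h0).projective
  π := (ChainComplex.toSingle₀Equiv _ _).symm
    ⟨(doubleXIso₁ S.f ChainComplex.down_rel_one_zero one_ne_zero).hom ≫ S.g,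
      double_d_comp_g S⟩
  quasiIso := ⟨fun n => by
    obtain _ | _ | n := n
    · rw [ChainComplex.quasiIsoAt₀_iff, ShortComplex.quasiIso_iff_of_zeros']
      · refine (ShortComplex.exact_and_epi_g_iff_of_iso ?_).2 ⟨hS.exact, hS.epi_g⟩
        refine ShortComplex.isoMk (doubleXIso₀ S.f ChainComplex.down_rel_one_zero)
          (doubleXIso₁ S.f ChainComplex.down_rel_one_zero one_ne_zero) (Iso.refl _)
          ?_ ?_
        · change _ = (double S.f ChainComplex.down_rel_one_zero).d 1 0 ≫ _
          simp [double_d S.f ChainComplex.down_rel_one_zero one_ne_zero]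
          rfl
        · refine Eq.trans ?_ (Category.comp_id _).symm
          exact (ChainComplex.toSingle₀Equiv_symm_apply_f_zero
            (C := double S.f ChainComplex.down_rel_one_zero) _ (double_d_comp_g S)).symm
      · exact double_d_eq_zero₀ S.f ChainComplex.down_rel_one_zero _ _ zero_ne_one
      all_goals rfl
    · rw [quasiIsoAt_iff_exactAt' _ _ (ChainComplex.exactAt_succ_single_obj _ _),
        HomologicalComplex.exactAt_iff' _ 2 1 0 (by simp) (by simp),
        ShortComplex.exact_iff_mono]
      · change Mono ((double S.f ChainComplex.down_rel_one_zero).d 1 0)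
        rw [double_d S.f ChainComplex.down_rel_one_zero one_ne_zero]
        have := hS.mono_f
        infer_instance
      · exact double_d_eq_zero₀ S.f ChainComplex.down_rel_one_zero _ _ (by simp)
    · rw [quasiIsoAt_iff_exactAt' _ _ (ChainComplex.exactAt_succ_single_obj _ _)]
      exact ShortComplex.exact_of_isZero_X₂ _
        (isZero_double_X S.f ChainComplex.down_rel_one_zero _ (by simp) (by simp))⟩

end CategoryTheory.ShortComplex.ShortExact

open CategoryTheory in
theorem CategoryTheory.ShortComplex.exists_surjective_homology {R : Type*} [Ring R]
    (S : ShortComplex (ModuleCat R)) (hS : S.g = 0) :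
    ∃ π : S.X₂ →ₗ[R] S.homology, Function.Surjective π ∧
      LinearMap.ker π = LinearMap.range S.f.hom := by
  let e : (LinearMap.ker S.g.hom ⧸ LinearMap.range S.moduleCatToCycles) ≃ₗ[R] S.homology :=
    S.moduleCatHomologyIso.symm.toLinearEquiv
  have hker (x) : S.g.hom x = 0 := by simp [hS]
  refine ⟨e.toLinearMap ∘ₗ (LinearMap.range S.moduleCatToCycles).mkQ ∘ₗ
    LinearMap.id.codRestrict (LinearMap.ker S.g.hom) hker, ?_, ?_⟩
  · exact e.surjective.comp ((Submodule.mkQ_surjective _).comp fun x => ⟨x.1, rfl⟩)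
  · rw [LinearEquiv.ker_comp, LinearMap.ker_comp, Submodule.ker_mkQ]
    ext x
    exact exists_congr fun y => Subtype.ext_iff

open CategoryTheory Limits HomologicalComplex in
theorem exists_surjective_ext_one {R : Type} [CommRing R] {A B M : Type} [AddCommGroup A]
    [AddCommGroup B] [AddCommGroup M] [Module R A] [Module R B] [Module R M]
    [Module.Projective R A] [Module.Projective R B] {i : A →ₗ[R] B} {p : B →ₗ[R] M}
    (hi : Function.Injective i) (h : Function.Exact i p) (hp : Function.Surjective p) :
    ∃ π : (A →ₗ[R] R) →ₗ[R] ExtGrp R M 1, Function.Surjective π ∧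
      ∀ f, π f = 0 ↔ ∃ g : B →ₗ[R] R, g ∘ₗ i = f := by
  let S : ShortComplex (ModuleCat R) := ShortComplex.mk (ModuleCat.ofHom i) (ModuleCat.ofHom p)
    (ModuleCat.hom_ext h.linearMap_comp_eq_zero)
  have : Projective S.X₁ := (IsProjective.iff_projective A).1 inferInstance
  have : Projective S.X₂ := (IsProjective.iff_projective B).1 inferInstance
  have hS : S.ShortExact :=
    { exact := (ShortComplex.ShortExact.moduleCat_exact_iff_function_exact S).2 h
      mono_f := (ModuleCat.mono_iff_injective _).2 hi
      epi_g := (ModuleCat.epi_iff_surjective _).2 hp }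
  let P := hS.projectiveResolution
  let L := P.complex.linearYonedaObj R (ModuleCat.of R R)
  have hL : (L.sc' 0 1 2).g = 0 := by
    refine ModuleCat.hom_ext (LinearMap.ext fun (x : P.complex.X 1 ⟶ _) => ?_)
    change P.complex.d 2 1 ≫ x = 0
    rw [show P.complex.d 2 1 = 0 from
      double_d_eq_zero₀ S.f ChainComplex.down_rel_one_zero _ _ (by simp), zero_comp]
  obtain ⟨π, hπ, hker⟩ := (L.sc' 0 1 2).exists_surjective_homology hL
  let e : (L.sc' 0 1 2).homology ≃ₗ[R] ExtGrp R M 1 :=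
    ((L.homologyIsoSc' 0 1 2 (by simp) (by simp)).symm ≪≫
      (P.isoExt 1 (ModuleCat.of R R)).symm).toLinearEquiv
  let e₁ : S.X₁ ≅ P.complex.X 1 := (doubleXIso₀ S.f ChainComplex.down_rel_one_zero).symm
  let e₀ : S.X₂ ≅ P.complex.X 0 :=
    (doubleXIso₁ S.f ChainComplex.down_rel_one_zero one_ne_zero).symm
  have hd : P.complex.d 1 0 = e₁.inv ≫ S.f ≫ e₀.hom :=
    double_d S.f ChainComplex.down_rel_one_zero one_ne_zero
  let a : (A →ₗ[R] R) ≃ₗ[R] (L.sc' 0 1 2).X₂ :=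
    (ModuleCat.homLinearEquiv (M := S.X₁) (N := ModuleCat.of R R) (S := R)).symm.trans
      (Linear.homCongr R e₁ (Iso.refl _))
  refine ⟨e.toLinearMap ∘ₗ π ∘ₗ a.toLinearMap,
    e.surjective.comp (hπ.comp a.surjective), fun f => ?_⟩
  have hrange : π (a f) = 0 ↔ ∃ y : P.complex.X 0 ⟶ ModuleCat.of R R,
      P.complex.d 1 0 ≫ y = e₁.inv ≫ ModuleCat.ofHom f := by
    rw [← LinearMap.mem_ker, hker]
    rfl
  refine (LinearEquiv.map_eq_zero_iff e).trans (hrange.trans ⟨?_, ?_⟩)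
  · rintro ⟨y, hy⟩
    refine ⟨(e₀.hom ≫ y).hom, ?_⟩
    rw [hd, Category.assoc, Category.assoc, Iso.cancel_iso_inv_left] at hy
    exact congrArg ModuleCat.Hom.hom hy
  · rintro ⟨g, rfl⟩
    refine ⟨e₀.inv ≫ ModuleCat.ofHom g, ?_⟩
    rw [hd]
    simp only [Category.assoc, Iso.hom_inv_id_assoc]
    rfl

/-- If the submodule `K` of `R ^ n` has a basis `b`, then a module presented by the restriction map
from the dual of `R ^ n` to the dual of `K` is presented by the matrix whose rows are the vectors
of `b`. -/
theorem exists_surjective_ker_eq_range_mulVecLin {R N : Type*} [CommRing R] [AddCommGroup N]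
    [Module R N] {k n : ℕ} {K : Submodule R (Fin n → R)} (b : Module.Basis (Fin k) R K)
    {π : (K →ₗ[R] R) →ₗ[R] N} (hπ : Function.Surjective π)
    (hker : ∀ f, π f = 0 ↔ ∃ g : (Fin n → R) →ₗ[R] R, g ∘ₗ K.subtype = f) :
    ∃ f : (Fin k → R) →ₗ[R] N, Function.Surjective f ∧ LinearMap.ker f =
      LinearMap.range (Matrix.of fun i => (b i : Fin n → R)).mulVecLin := by
  have hB (w : Fin n → R) : b.constr R ((Matrix.of fun i => (b i : Fin n → R)).mulVec w) =
      dotProductBilin R R w ∘ₗ K.subtype :=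
    b.ext fun i => by
      rw [b.constr_basis]
      exact dotProduct_comm _ _
  refine ⟨π ∘ₗ (b.constr R).toLinearMap, hπ.comp (b.constr R).surjective, ?_⟩
  ext x
  refine (hker _).trans ⟨?_, ?_⟩
  · rintro ⟨g, hg⟩
    refine ⟨fun j => g (Pi.single j 1), (b.constr R).injective (((hB _).trans ?_).trans hg)⟩
    congr 1
    ext j
    simp
  · rintro ⟨w, rfl⟩
    exact ⟨_, (hB w).symm⟩

/-- Over a ring with finitely many maximal ideals, a module of projective dimension at most one and
generic rank one is presented by the transpose of a `k × (k + 1)` matrix `B`, so that `B` presents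
its first `Ext` group with values in the ring. -/
theorem ProjDimLEOne.exists_surjective_ext_one {R M : Type} [CommRing R] [Nontrivial R]
    [IsNoetherianRing R] [Finite (MaximalSpectrum R)] [AddCommGroup M] [Module R M]
    (hM : ProjDimLEOne R M) (hrk : GenericRankOne R M) :
    ∃ (k : ℕ) (B : Matrix (Fin k) (Fin (k + 1)) R) (f : (Fin k → R) →ₗ[R] ExtGrp R M 1),
      Function.Surjective f ∧ LinearMap.ker f = LinearMap.range B.mulVecLin := by
  obtain ⟨n, φ, hφ, hproj⟩ := hM
  have hrank := hrk.rankAtStalk_ker_add_one hφ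
  obtain ⟨p⟩ : Nonempty (PrimeSpectrum R) := inferInstance
  obtain ⟨k, rfl⟩ : ∃ k, n = k + 1 := ⟨_, (hrank p).symm⟩
  obtain ⟨b⟩ := Module.nonempty_basis_of_rankAtStalk_eq fun p => Nat.succ_injective (hrank p)
  obtain ⟨π, hπ, hker⟩ := _root_.exists_surjective_ext_one (LinearMap.ker φ).injective_subtype
    (LinearMap.exact_subtype_ker_map φ) hφ
  exact ⟨k, _, exists_surjective_ker_eq_range_mulVecLin b hπ hker⟩

theorem ProjDimLETwo.of_subsingleton {R N : Type} [CommRing R] [AddCommGroup N] [Module R N]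
    [Subsingleton N] : ProjDimLETwo R N :=
  ⟨0, 0, Function.surjective_to_subsingleton _, 0, 0, Function.surjective_to_subsingleton _,
    inferInstance⟩

theorem ProjDimLETwo.of_ker_eq_range {R N : Type} [CommRing R] [AddCommGroup N] [Module R N]
    {m n : ℕ} {f : (Fin m → R) →ₗ[R] N} (hf : Function.Surjective f)
    {g : (Fin n → R) →ₗ[R] (Fin m → R)} (h : LinearMap.ker f = LinearMap.range g)
    (hg : Module.Projective R (LinearMap.ker g)) : ProjDimLETwo R N := by
  refine ⟨m, f, hf, n, g.codRestrict _ fun x => h ▸ ⟨x, rfl⟩, ?_, ?_⟩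
  · rintro ⟨y, hy⟩
    obtain ⟨x, rfl⟩ := h ▸ hy
    exact ⟨x, rfl⟩
  · rwa [LinearMap.ker_codRestrict]

/-- Let `Λ` be a commutative Noetherian regular local ring and `𝓡` a commutative
`Λ`-algebra, free of finite rank as a `Λ`-module, with `Hom_Λ(𝓡, Λ) ≅ 𝓡` as
`𝓡`-modules.  Let `M` be a finitely generated `𝓡`-module with `pd_𝓡(M) ≤ 1` such that
`N = Ext¹_𝓡(M, 𝓡)` is pseudo-null and `M` has generic rank one over `𝓡`.  Then
`pd_𝓡(N) ≤ 2`. -/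
theorem ext_projDim_le_two
    (Λ 𝓡 : Type) [CommRing Λ] [IsNoetherianRing Λ] [IsLocalRing Λ]
    (hreg : IsRegularLocal Λ)
    [CommRing 𝓡] [Algebra Λ 𝓡] [Module.Free Λ 𝓡] [Module.Finite Λ 𝓡]
    (hdual : SelfDualAlgebra Λ 𝓡)
    (M : Type) [AddCommGroup M] [Module 𝓡 M] [Module.Finite 𝓡 M]
    (hpd : ProjDimLEOne 𝓡 M)
    (hPN : IsPseudoNull Λ (𝓡 := 𝓡) ↥(ExtGrp 𝓡 M 1))
    (hrk : GenericRankOne 𝓡 M) :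
    ProjDimLETwo 𝓡 ↥(ExtGrp 𝓡 M 1) := by
  have : IsNoetherianRing 𝓡 := .of_finite Λ 𝓡
  have := finite_maximalSpectrum_of_finite Λ 𝓡
  cases subsingleton_or_nontrivial 𝓡
  · have := Module.subsingleton 𝓡 (ExtGrp 𝓡 M 1)
    exact .of_subsingleton
  · obtain ⟨k, B, f, hf, hker⟩ := hpd.exists_surjective_ext_one hrk
    exact .of_ker_eq_range hf hker
      (projective_ker_mulVecLin_of_isPseudoNull hreg hPN B f hker.le)
end
end

section
/- Let M be a finitely generated 𝓡-module with pd_𝓡(M) ≤ 1 such that N = E¹(M) = Ext¹_𝓡(M, 𝓡) is pseudo-null and such that M has generic rank one over 𝓡 (i.e., M ⊗_𝓡 Q(𝓡) is a free Q(𝓡)-module of rank one). Then E²(N) = Ext²_𝓡(N, 𝓡) is a cyclic 𝓡-module, i.e., it is generated by a single element (equivalently, isomorphic to 𝓡/I for some ideal I of 𝓡). -/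
noncomputable section

open IsLocalRing in
lemma exists_isRegularLocalRing_quotient_span_singleton {R : Type*} [CommRing R]
    [IsRegularLocalRing R] {x : R} (hx : x ∈ maximalIdeal R) (hx2 : x ∉ maximalIdeal R ^ 2) :
    ∃ _ : IsRegularLocalRing (R ⧸ Ideal.span {x}),
      (maximalIdeal (R ⧸ Ideal.span {x})).spanFinrank + 1 = (maximalIdeal R).spanFinrank := by
  have : Nontrivial (R ⧸ Ideal.span {x}) := Ideal.Quotient.nontrivial_iff.mpr fun h ↦
    (maximalIdeal.isMaximal R).ne_top
      (top_le_iff.mp (h ▸ (Ideal.span_singleton_le_iff_mem _).mpr hx))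
  have hloc : IsLocalRing (R ⧸ Ideal.span {x}) :=
    IsLocalRing.of_surjective' (Ideal.Quotient.mk _) Ideal.Quotient.mk_surjective
  have hle : (maximalIdeal (R ⧸ Ideal.span {x})).spanFinrank + 1 ≤
      (maximalIdeal R).spanFinrank := by
    set v : CotangentSpace R := (maximalIdeal R).toCotangent ⟨x, hx⟩ with hv
    have hv0 : v ≠ 0 := fun h ↦ hx2 (((maximalIdeal R).toCotangent_eq_zero _).mp h)
    have hli : LinearIndepOn (ResidueField R) id {v} := .singleton hv0
    set B := hli.extend (Set.subset_univ _)
    let b : Module.Basis B (ResidueField R) (CotangentSpace R) := Module.Basis.extend hli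
    have hvB : v ∈ B := hli.subset_extend _ rfl
    have hBfin : B.Finite := Set.finite_coe_iff.mp (Module.Finite.finite_basis b)
    have hBcard : B.ncard = (maximalIdeal R).spanFinrank := by
      rw [spanFinrank_maximalIdeal_eq_finrank_cotangentSpace, Module.finrank_eq_nat_card_basis b]
      rfl
    have hBspan : Submodule.span (ResidueField R) B = ⊤ := by
      rw [← b.span_eq, Module.Basis.range_extend]
    let σ : CotangentSpace R → maximalIdeal R :=
      Function.surjInv (maximalIdeal R).toCotangent_surjective
    have hσ (u) : (maximalIdeal R).toCotangent (σ u) = u := Function.surjInv_eq _ u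
    let s : Set (maximalIdeal R) := insert ⟨x, hx⟩ (σ '' (B \ {v}))
    have hs : Submodule.span R s = ⊤ := by
      rw [← CotangentSpace.span_image_eq_top_iff, ← top_le_iff, ← hBspan]
      refine Submodule.span_mono fun u hu ↦ ?_
      by_cases huv : u = v
      · exact ⟨⟨x, hx⟩, Set.mem_insert _ _, huv.symm⟩
      · exact ⟨σ u, Set.mem_insert_of_mem _ ⟨u, ⟨hu, huv⟩, rfl⟩, hσ u⟩
    have hm : maximalIdeal (R ⧸ Ideal.span {x}) =
        Ideal.span ((fun u ↦ Ideal.Quotient.mk (Ideal.span {x}) (σ u)) '' (B \ {v})) := by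
      have hgen : Ideal.span ((maximalIdeal R).subtype '' s) = maximalIdeal R := by
        rw [Ideal.span, ← Submodule.map_span, hs, Submodule.map_top, Submodule.range_subtype]
      rw [← map_maximalIdeal_of_surjective _ (Ideal.Quotient.mk_surjective (I := Ideal.span {x}))]
      refine (congrArg (Ideal.map _) hgen.symm).trans ?_
      rw [Ideal.map_span]
      simp only [s, Set.image_insert_eq, Set.image_image]
      apply le_antisymm
      · rw [Ideal.span_le]
        rintro _ (rfl | h)
        · simp
        · exact Ideal.subset_span h
      · exact Ideal.span_mono (Set.subset_insert _ _)
    rw [hm, ← hBcard, ← Set.ncard_sdiff_singleton_add_one hvB hBfin]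
    gcongr
    exact (Submodule.spanFinrank_span_le_ncard_of_finite ((hBfin.sdiff).image _)).trans
      (Set.ncard_image_le hBfin.sdiff)
  have hdim : ringKrullDim R ≤ ringKrullDim (R ⧸ Ideal.span {x}) + 1 := by
    simpa only [Set.encard_singleton, WithBot.coe_one] using
      ringKrullDim_le_ringKrullDim_quotient_add_encard {x} (by simpa [ringJacobson_eq_maximalIdeal R] using hx)
  rw [← IsRegularLocalRing.spanFinrank_maximalIdeal] at hdim
  have hdim' := ringKrullDim_le_spanFinrank_maximalIdeal (R ⧸ Ideal.span {x})
  have hge : (maximalIdeal R).spanFinrank ≤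
      (maximalIdeal (R ⧸ Ideal.span {x})).spanFinrank + 1 := by
    have := hdim.trans (add_le_add_left hdim' 1)
    exact_mod_cast this
  refine ⟨.of_spanFinrank_maximalIdeal_le _ ?_, le_antisymm hle hge⟩
  have h1 : (((maximalIdeal (R ⧸ Ideal.span {x})).spanFinrank : WithBot ℕ∞) + 1) ≤
      ringKrullDim (R ⧸ Ideal.span {x}) + 1 := by
    refine le_trans ?_ hdim
    exact_mod_cast hle
  exact ENat.WithBot.add_le_add_one_right_iff.mp h1

open IsLocalRing in
lemma exists_mem_maximalIdeal_notMem {R : Type*} [CommRing R] [IsNoetherianRing R]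
    [IsLocalRing R] (hR : ¬ IsField R) {S : Set (Ideal R)} (hS : S.Finite)
    (hSp : ∀ p ∈ S, p.IsPrime) (hSm : maximalIdeal R ∉ S) :
    ∃ x ∈ maximalIdeal R, x ∉ maximalIdeal R ^ 2 ∧ ∀ p ∈ S, x ∉ p := by
  by_contra! H
  have hsub : (maximalIdeal R : Set R) ⊆ ⋃ p ∈ insert (maximalIdeal R ^ 2) S, (p : Set R) := by
    intro x hx
    by_cases h2 : x ∈ maximalIdeal R ^ 2
    · exact Set.mem_biUnion (Set.mem_insert _ _) h2
    · obtain ⟨p, hp, hxp⟩ := H x hx h2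
      exact Set.mem_biUnion (Set.mem_insert_of_mem _ hp) hxp
  rw [Ideal.subset_union_prime_finite (f := fun p ↦ p) (hS.insert _) (maximalIdeal R ^ 2)
    (maximalIdeal R ^ 2) (fun p hp h _ ↦ hSp p (hp.resolve_left h))] at hsub
  obtain ⟨p, rfl | hp, hle⟩ := hsub
  · refine hR (isField_iff_maximalIdeal_eq.mpr ?_)
    refine Submodule.eq_bot_of_le_smul_of_le_jacobson_bot (maximalIdeal R) _
      (IsNoetherian.noetherian _) (by simpa [pow_two] using hle) ?_
    exact (jacobson_eq_maximalIdeal ⊥ bot_ne_top).ge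
  · have := hSp p hp
    exact hSm ((IsLocalRing.maximalIdeal.isMaximal R).eq_of_le this.ne_top hle ▸ hp)

open IsLocalRing in
theorem IsRegularLocalRing.isDomain_of_spanFinrank_eq (n : ℕ) {R : Type*} [CommRing R]
    [IsRegularLocalRing R] (hn : (maximalIdeal R).spanFinrank = n) : IsDomain R := by
  induction n generalizing R with
  | zero =>
    have : maximalIdeal R = ⊥ :=
      (Submodule.spanFinrank_eq_zero_iff_eq_bot (IsNoetherian.noetherian _)).mp hn
    exact (isField_iff_maximalIdeal_eq.mpr this).isDomain
  | succ n ih =>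
    have hdim : ringKrullDim R = (n + 1 : ℕ) := by
      rw [← hn, IsRegularLocalRing.spanFinrank_maximalIdeal]
    have hmin : maximalIdeal R ∉ minimalPrimes R := fun h ↦ by
      have := Ideal.height_eq_zero_iff.mpr h
      rw [← maximalIdeal_height_eq_ringKrullDim, this] at hdim
      norm_cast at hdim
    have hR : ¬ IsField R := fun h ↦ by
      have := ringKrullDim_eq_zero_of_isField h
      rw [hdim] at this
      norm_cast at this
    obtain ⟨x, hx, hx2, hxp⟩ := exists_mem_maximalIdeal_notMem hR
      (minimalPrimes.finite_of_isNoetherianRing R) (fun p hp ↦ hp.1.1) hmin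
    obtain ⟨_, hrank⟩ := exists_isRegularLocalRing_quotient_span_singleton hx hx2
    have := ih (R := R ⧸ Ideal.span {x}) (by lia)
    have hprime : (Ideal.span {x}).IsPrime := (Ideal.Quotient.isDomain_iff_prime _).mp this
    obtain ⟨p, hp, hpx⟩ := Ideal.exists_minimalPrimes_le (I := ⊥) (J := Ideal.span {x}) bot_le
    have hpp : p.IsPrime := hp.1.1
    have hbot : p = ⊥ := by
      refine Submodule.eq_bot_of_le_smul_of_le_jacobson_bot (maximalIdeal R) _
        (IsNoetherian.noetherian _) (fun y hy ↦ ?_) (jacobson_eq_maximalIdeal ⊥ bot_ne_top).ge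
      obtain ⟨z, rfl⟩ := Ideal.mem_span_singleton'.mp (hpx hy)
      rw [mul_comm]
      exact Submodule.smul_mem_smul hx ((hpp.mem_or_mem hy).resolve_right (hxp p hp))
    subst hbot
    exact IsDomain.of_bot_isPrime R

lemma isAssociatedPrime_quotient_iff {R : Type*} [CommRing R] [IsNoetherianRing R]
    {I p : Ideal R} :
    IsAssociatedPrime p (R ⧸ I) ↔ p.IsPrime ∧ ∃ y, ∀ z, z ∈ p ↔ z * y ∈ I := by
  rw [isAssociatedPrime_iff]
  refine and_congr_right fun _ ↦ ⟨?_, ?_⟩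
  · rintro ⟨y, rfl⟩
    obtain ⟨y, rfl⟩ := Ideal.Quotient.mk_surjective y
    refine ⟨y, fun z ↦ ?_⟩
    rw [Submodule.mem_colon_singleton, Submodule.mem_bot, ← Ideal.Quotient.eq_zero_iff_mem]
    rfl
  · rintro ⟨y, hy⟩
    refine ⟨Ideal.Quotient.mk I y, ?_⟩
    ext z
    rw [Submodule.mem_colon_singleton, Submodule.mem_bot, hy, ← Ideal.Quotient.eq_zero_iff_mem]
    rfl

open IsLocalRing in
lemma IsRegularLocalRing.not_isAssociatedPrime_maximalIdeal {R : Type*} [CommRing R]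
    [IsRegularLocalRing R] (hn : 2 ≤ (maximalIdeal R).spanFinrank) {a : R} (ha : a ≠ 0) :
    ¬ IsAssociatedPrime (maximalIdeal R) (R ⧸ Ideal.span {a}) := by
  have := isDomain_of_spanFinrank_eq _ (rfl : (maximalIdeal R).spanFinrank = _)
  have hR : ¬ IsField R := fun h ↦ by
    rw [isField_iff_maximalIdeal_eq] at h
    simp [h] at hn
  obtain ⟨x, hx, hx2, -⟩ := exists_mem_maximalIdeal_notMem hR (S := ∅) Set.finite_empty
    (by simp) (by simp)
  obtain ⟨_, -⟩ := exists_isRegularLocalRing_quotient_span_singleton hx hx2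
  have := isDomain_of_spanFinrank_eq _
    (rfl : (maximalIdeal (R ⧸ Ideal.span {x})).spanFinrank = _)
  have hprime : (Ideal.span {x}).IsPrime := (Ideal.Quotient.isDomain_iff_prime _).mp this
  obtain ⟨x', hx', hx'x⟩ : ∃ x' ∈ maximalIdeal R, x' ∉ Ideal.span {x} := by
    by_contra! h
    have : maximalIdeal R = Ideal.span {x} :=
      le_antisymm h ((Ideal.span_singleton_le_iff_mem _).mpr hx)
    have h1 := Submodule.spanFinrank_span_le_ncard_of_finite (R := R) (Set.finite_singleton x)
    rw [Set.ncard_singleton] at h1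
    rw [this] at hn
    exact absurd (hn.trans h1) (by decide)
  intro h
  obtain ⟨-, y, hy⟩ := isAssociatedPrime_quotient_iff.mp h
  obtain ⟨u, hu⟩ := Ideal.mem_span_singleton'.mp ((hy x).mp hx)
  obtain ⟨v, hv⟩ := Ideal.mem_span_singleton'.mp ((hy x').mp hx')
  have hx0 : x ≠ 0 := fun h ↦ hx2 (h ▸ zero_mem _)
  have huv : x' * u ∈ Ideal.span {x} := by
    refine Ideal.mem_span_singleton'.mpr ⟨v, mul_right_cancel₀ ha ?_⟩
    linear_combination x * hv - x' * hu
  obtain ⟨w, rfl⟩ := Ideal.mem_span_singleton'.mp ((hprime.mem_or_mem huv).resolve_left hx'x)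
  refine (maximalIdeal.isMaximal R).ne_top ((Ideal.eq_top_iff_one _).mpr ((hy 1).mpr ?_))
  refine Ideal.mem_span_singleton'.mpr ⟨w, mul_left_cancel₀ hx0 ?_⟩
  linear_combination hu

open IsLocalRing in
theorem IsRegularLocalRing.height_le_one_of_isAssociatedPrime (n : ℕ) {R : Type*} [CommRing R]
    [IsRegularLocalRing R] (hn : (maximalIdeal R).spanFinrank = n) {a : R} (ha : a ≠ 0)
    {p : Ideal R} (hp : IsAssociatedPrime p (R ⧸ Ideal.span {a})) : p.height ≤ 1 := by
  induction n generalizing R with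
  | zero =>
    have := Ideal.height_le_ringKrullDim_of_ne_top hp.isPrime.ne_top
    rw [← IsRegularLocalRing.spanFinrank_maximalIdeal, hn] at this
    exact (show p.height ≤ (0 : ℕ) by exact_mod_cast this).trans (by simp)
  | succ n ih =>
    by_cases hn2 : n + 1 < 2
    · have := Ideal.height_le_ringKrullDim_of_ne_top hp.isPrime.ne_top
      rw [← IsRegularLocalRing.spanFinrank_maximalIdeal, hn] at this
      exact (show p.height ≤ (n + 1 : ℕ) by exact_mod_cast this).trans
        (by exact_mod_cast Nat.le_of_lt_succ hn2)
    have hm := not_isAssociatedPrime_maximalIdeal (by lia) ha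
    have hR : ¬ IsField R := fun h ↦ by
      rw [isField_iff_maximalIdeal_eq] at h
      simp [h] at hn
    have := isDomain_of_spanFinrank_eq _ hn
    obtain ⟨x, hx, hx2, hxS⟩ := exists_mem_maximalIdeal_notMem hR
      (associatedPrimes.finite R (R ⧸ Ideal.span {a})) (fun p hp ↦ hp.isPrime) hm
    have hreg (z : R) (hz : x * z ∈ Ideal.span {a}) : z ∈ Ideal.span {a} := by
      by_contra hza
      rw [← Ideal.Quotient.eq_zero_iff_mem] at hza
      obtain ⟨q, hq, hle⟩ := exists_le_isAssociatedPrime_of_isNoetherianRing R _ hza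
      refine hxS q hq (hle ?_)
      rw [Submodule.mem_colon_singleton, Submodule.mem_bot]
      exact Ideal.Quotient.eq_zero_iff_mem.mpr hz
    obtain ⟨_, hrank⟩ := exists_isRegularLocalRing_quotient_span_singleton hx hx2
    obtain ⟨hpp, y, hy⟩ := isAssociatedPrime_quotient_iff.mp hp
    have hya : y ∉ Ideal.span {a} := fun h ↦
      hpp.ne_top ((Ideal.eq_top_iff_one _).mpr ((hy 1).mpr (by simpa using h)))
    have hax : a ∉ Ideal.span {x} := fun h ↦ by
      obtain ⟨c, hc⟩ := Ideal.mem_span_singleton'.mp h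
      obtain ⟨d, hd⟩ := Ideal.mem_span_singleton'.mp
        (hreg c (Ideal.mem_span_singleton'.mpr ⟨1, by linear_combination -hc⟩))
      have hu : IsUnit (1 - x * d) := by
        by_contra hnu
        refine (maximalIdeal.isMaximal R).ne_top ((Ideal.eq_top_iff_one _).mpr ?_)
        have := add_mem ((mem_maximalIdeal _).mpr hnu) (Ideal.mul_mem_right d _ hx)
        rwa [sub_add_cancel] at this
      have hc0 : (1 - x * d) * c = 0 := by linear_combination -hd - d * hc
      rw [hu.mul_right_eq_zero] at hc0
      simp [hc0] at hc
      exact ha hc.symm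
    let L : Ideal R := (Ideal.span {a}).colon (p : Set R)
    have hL (z : R) : z ∈ L ↔ ∀ t ∈ p, t * z ∈ Ideal.span {a} := by
      simp only [L, Submodule.mem_colon, smul_eq_mul, SetLike.mem_coe, mul_comm z]
    obtain ⟨z, hzL, hz⟩ : ∃ z ∈ L, z ∉ Ideal.span {a} ⊔ Ideal.span {x} := by
      by_contra! h
      refine hya ?_
      have hyL : y ∈ L := (hL y).mpr fun t ht ↦ (hy t).mp ht
      refine Submodule.le_of_le_smul_of_le_jacobson_bot (I := maximalIdeal R)
        (IsNoetherian.noetherian L) (jacobson_eq_maximalIdeal ⊥ bot_ne_top).ge (fun z hz ↦ ?_) hyL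
      obtain ⟨u, hu, v, hv, rfl⟩ := Submodule.mem_sup.mp (h z hz)
      obtain ⟨w, rfl⟩ := Ideal.mem_span_singleton'.mp hv
      refine Submodule.add_mem_sup hu ?_
      rw [mul_comm]
      refine Submodule.smul_mem_smul hx ((hL w).mpr fun t ht ↦ hreg _ ?_)
      have := sub_mem ((hL _).mp hz t ht) (Ideal.mul_mem_left _ t hu)
      convert this using 1
      ring
    have hz' : Ideal.Quotient.mk (Ideal.span {Ideal.Quotient.mk (Ideal.span {x}) a})
        (Ideal.Quotient.mk (Ideal.span {x}) z) ≠ 0 := by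
      rw [Ne, Ideal.Quotient.eq_zero_iff_mem, Ideal.mem_span_singleton']
      rintro ⟨c, hc⟩
      obtain ⟨c, rfl⟩ := Ideal.Quotient.mk_surjective c
      rw [← map_mul, Ideal.Quotient.mk_eq_mk_iff_sub_mem] at hc
      refine hz ?_
      have := Submodule.add_mem_sup (Ideal.mul_mem_left (Ideal.span {a}) c
        (Ideal.mem_span_singleton_self a)) (neg_mem hc)
      convert this using 1
      ring
    obtain ⟨P, hP, hle⟩ := exists_le_isAssociatedPrime_of_isNoetherianRing
      (R ⧸ Ideal.span {x}) _ hz'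
    have hPh := ih (R := R ⧸ Ideal.span {x}) (by lia)
      (by rwa [Ne, Ideal.Quotient.eq_zero_iff_mem]) hP
    have hPp := hP.isPrime
    have hxP : x ∈ P.comap (Ideal.Quotient.mk (Ideal.span {x})) := by
      rw [Ideal.mem_comap, Ideal.Quotient.eq_zero_iff_mem.mpr (Ideal.mem_span_singleton_self x)]
      exact zero_mem _
    have h2 := Ideal.height_le_height_add_one_of_mem hxP
    rw [Ideal.map_comap_of_surjective _ Ideal.Quotient.mk_surjective] at h2
    have hlt : p < P.comap (Ideal.Quotient.mk (Ideal.span {x})) := by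
      refine lt_of_le_of_ne (fun t ht ↦ hle ?_) fun h ↦ hxS p hp (h ▸ hxP)
      rw [Submodule.mem_colon_singleton, Submodule.mem_bot]
      refine Ideal.Quotient.eq_zero_iff_mem.mpr ?_
      obtain ⟨c, hc⟩ := Ideal.mem_span_singleton'.mp ((hL z).mp hzL t ht)
      rw [Ideal.mem_span_singleton']
      exact ⟨Ideal.Quotient.mk _ c, by rw [← map_mul, hc, map_mul]; rfl⟩
    have h3 := Ideal.height_add_one_le_of_lt_of_isPrime hlt
    have h4 : p.height + 1 ≤ 1 + 1 := h3.trans (h2.trans (by gcongr))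
    exact (ENat.add_le_add_iff_right (by simp)).mp h4

open IsLocalRing in
theorem IsRegularLocalRing.exists_regular_pair {R : Type*} [CommRing R]
    [IsRegularLocalRing R] {J : Ideal R}
    (hJ : ∀ q : Ideal R, q.IsPrime → q.height ≤ 1 → ¬ J ≤ q) :
    ∃ a ∈ J, a ≠ 0 ∧ ∃ b ∈ J, ∀ z, a ∣ b * z → a ∣ z := by
  have := isDomain_of_spanFinrank_eq _ (rfl : (maximalIdeal R).spanFinrank = _)
  obtain ⟨a, haJ, ha⟩ := Set.not_subset.mp (hJ ⊥ Ideal.isPrime_bot (by simp))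
  refine ⟨a, haJ, by rintro rfl; exact ha (zero_mem _), ?_⟩
  by_contra! H
  have hsub : (J : Set R) ⊆ ⋃ p ∈ associatedPrimes R (R ⧸ Ideal.span {a}), (p : Set R) := by
    intro b hb
    obtain ⟨z, hz, hza⟩ := H b hb
    rw [biUnion_associatedPrimes_eq_zero_divisors]
    refine ⟨Ideal.Quotient.mk _ z, ?_, ?_⟩
    · rwa [Ne, Ideal.Quotient.eq_zero_iff_mem, Ideal.mem_span_singleton]
    · exact Ideal.Quotient.eq_zero_iff_mem.mpr (Ideal.mem_span_singleton.mpr hz)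
  rw [Ideal.subset_union_prime_finite (f := fun p ↦ p) (associatedPrimes.finite R _) ⊥ ⊥
    (fun p hp _ _ ↦ IsAssociatedPrime.isPrime hp)] at hsub
  obtain ⟨p, hp, hle⟩ := hsub
  exact hJ p hp.isPrime
    (height_le_one_of_isAssociatedPrime _ rfl (by rintro rfl; exact ha (zero_mem _)) hp) hle

lemma Module.Free.smul_eq_zero_of_ne_zero {A S : Type*} [CommRing A] [IsDomain A]
    [AddCommGroup S] [Module A S] [Module.Free A S] {a : A} (ha : a ≠ 0) {z : S}
    (hz : a • z = 0) : z = 0 := by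
  refine (Module.Free.chooseBasis A S).ext_elem fun i ↦ ?_
  have := congrArg (fun t ↦ (Module.Free.chooseBasis A S).repr t i) hz
  simpa [ha] using this

lemma Module.Free.exists_eq_smul {A S : Type*} [CommRing A]
    [AddCommGroup S] [Module A S] [Module.Free A S] [Module.Finite A S] {a b : A}
    (h : ∀ z, a ∣ b * z → a ∣ z) {z t : S} (hz : b • z = a • t) : ∃ w, z = a • w := by
  let e := Module.Free.chooseBasis A S
  have hrepr (i) : ∃ w, e.repr z i = a * w := by
    refine h _ ⟨e.repr t i, ?_⟩
    simpa using congrArg (fun t ↦ e.repr t i) hz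
  choose w hw using hrepr
  refine ⟨e.equivFun.symm w, e.ext_elem fun i ↦ ?_⟩
  rw [map_smul, Finsupp.smul_apply, ← e.equivFun_apply (e.equivFun.symm w),
    LinearEquiv.apply_symm_apply, hw, smul_eq_mul]

lemma IsRegularLocal.isRegularLocalRing {A : Type} [CommRing A] [IsNoetherianRing A]
    [IsLocalRing A] (h : IsRegularLocal A) : IsRegularLocalRing A := by
  obtain ⟨s, hs, hcard⟩ := h
  refine .of_spanFinrank_maximalIdeal_le _ ?_
  rw [← hs, ← hcard]
  have := Submodule.spanFinrank_span_le_ncard_of_finite (R := A) s.finite_toSet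
  rw [Set.ncard_coe_finset] at this
  exact Nat.mono_cast (α := WithBot ℕ∞) this

lemma HeightLEOne.of_height_le_one {A : Type} [CommRing A] {q : Ideal A} [q.IsPrime]
    (h : q.height ≤ 1) : HeightLEOne A q := by
  rintro ⟨q₀, q₁, h₀, h₁, h₀₁, h₁q⟩
  have h2 := Ideal.height_add_one_le_of_lt_of_isPrime h₀₁
  have h3 := Ideal.height_add_one_le_of_lt_of_isPrime h₁q
  have h4 : (0 : ℕ∞) + 1 + 1 ≤ 1 :=
    (show _ ≤ q₀.height + 1 + 1 by gcongr; exact zero_le).trans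
      ((show _ ≤ q₁.height + 1 by gcongr).trans (h3.trans h))
  exact absurd h4 (by decide)

/-- An ideal of a finite free algebra over a regular local ring which meets the complement of
every prime of height at most one contains a weakly regular sequence of length two. -/
theorem exists_weaklyRegular_pair {A S : Type} [CommRing A] [IsNoetherianRing A]
    [IsLocalRing A] (hA : IsRegularLocal A) [CommRing S] [Algebra A S] [Module.Free A S]
    [Module.Finite A S] {J : Ideal S}
    (hJ : ∀ q : Ideal A, q.IsPrime → HeightLEOne A q → ∃ s ∉ q, algebraMap A S s ∈ J) :
    ∃ a ∈ J, ∃ b ∈ J, (∀ z, a * z = 0 → z = 0) ∧ ∀ z t, b * z = a * t → ∃ w, z = a * w := by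
  have := hA.isRegularLocalRing
  have := IsRegularLocalRing.isDomain_of_spanFinrank_eq _
    (rfl : (IsLocalRing.maximalIdeal A).spanFinrank = _)
  obtain ⟨a, haJ, ha, b, hbJ, h⟩ := IsRegularLocalRing.exists_regular_pair
    (J := J.comap (algebraMap A S)) fun q hq hq1 hle ↦ by
      obtain ⟨s, hs, hsJ⟩ := hJ q hq (.of_height_le_one hq1)
      exact hs (hle hsJ)
  refine ⟨_, haJ, _, hbJ, fun z hz ↦ ?_, fun z t hz ↦ ?_⟩
  · exact Module.Free.smul_eq_zero_of_ne_zero ha (by rwa [Algebra.smul_def])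
  · simp only [← Algebra.smul_def] at hz ⊢
    exact Module.Free.exists_eq_smul h hz

section Minors

open Matrix

variable {S : Type*} {k : ℕ}

/-- The square matrix obtained by adding a first row to a `k × (k + 1)` matrix. -/
def addRow (A : Matrix (Fin k) (Fin (k + 1)) S) (c : Fin (k + 1) → S) :
    Matrix (Fin (k + 1)) (Fin (k + 1)) S :=
  Matrix.of (Fin.cons c A)

@[simp]
lemma addRow_zero (A : Matrix (Fin k) (Fin (k + 1)) S) (c : Fin (k + 1) → S) :
    addRow A c 0 = c := rfl

@[simp]
lemma addRow_succ (A : Matrix (Fin k) (Fin (k + 1)) S) (c : Fin (k + 1) → S) (j : Fin k) :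
    addRow A c j.succ = A j := rfl

variable [CommRing S]

/-- The vector of signed maximal minors of a `k × (k + 1)` matrix. -/
def maxMinors (A : Matrix (Fin k) (Fin (k + 1)) S) (i : Fin (k + 1)) : S :=
  (addRow A 0).adjugate i 0

lemma adjugate_addRow_zero (A : Matrix (Fin k) (Fin (k + 1)) S) (c : Fin (k + 1) → S)
    (i : Fin (k + 1)) : (addRow A c).adjugate i 0 = maxMinors A i := by
  rw [maxMinors, adjugate_apply, adjugate_apply]
  congr 1
  ext j l
  refine Fin.cases ?_ (fun j ↦ ?_) j <;> simp [updateRow_apply]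

lemma det_addRow (A : Matrix (Fin k) (Fin (k + 1)) S) (c : Fin (k + 1) → S) :
    (addRow A c).det = c ⬝ᵥ maxMinors A := by
  have := congrFun (congrFun (mul_adjugate (addRow A c)) 0) 0
  rw [mul_apply] at this
  simp only [adjugate_addRow_zero, Matrix.smul_apply, one_apply_eq, smul_eq_mul, mul_one] at this
  exact this.symm

lemma mulVec_maxMinors (A : Matrix (Fin k) (Fin (k + 1)) S) : A *ᵥ maxMinors A = 0 := by
  ext j
  have := congrFun (congrFun (mul_adjugate (addRow A 0)) j.succ) 0
  simp only [mul_apply, adjugate_addRow_zero, addRow_succ] at this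
  exact this.trans (by simp)

lemma det_addRow_smul (A : Matrix (Fin k) (Fin (k + 1)) S) (c : Fin (k + 1) → S)
    {w : Fin (k + 1) → S} (hw : A *ᵥ w = 0) :
    (addRow A c).det • w = (c ⬝ᵥ w) • maxMinors A := by
  have h1 : addRow A c *ᵥ w = Pi.single 0 (c ⬝ᵥ w) := by
    ext j
    refine Fin.cases ?_ (fun j ↦ ?_) j
    · simp [mulVec]
    · simpa [mulVec] using congrFun hw j
  have h2 := congrArg ((addRow A c).adjugate *ᵥ ·) h1
  simp only [mulVec_mulVec, adjugate_mul, smul_mulVec, one_mulVec] at h2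
  rw [h2]
  ext i
  rw [mulVec_single]
  simp [adjugate_addRow_zero, mul_comm]

lemma pow_mem_span_maxMinors (A : Matrix (Fin k) (Fin (k + 1)) S)
    (B : Matrix (Fin (k + 1)) (Fin k) S) {s : S} (h : A * B = s • 1) :
    s ^ (k + 1) ∈ Ideal.span (Set.range (maxMinors A)) := by
  set D : Matrix (Fin (k + 1)) (Fin (k + 1)) S := s • 1 - B * A with hD
  have hAD : A * D = 0 := by
    rw [hD, Matrix.mul_sub, ← Matrix.mul_assoc, h]
    simp
  have htr : D.trace = s := by
    rw [hD, trace_sub, trace_mul_comm, h]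
    simp [mul_add]
  have hmem (j) : D j j * s ^ k ∈ Ideal.span (Set.range (maxMinors A)) := by
    let C : Matrix (Fin (k + 1)) (Fin (k + 1)) S := Matrix.of fun i ↦ Fin.cons (D i j) (B i)
    have h0 (i) : (addRow A (Pi.single j 1) * C) (Fin.succ i) 0 = 0 := by
      simpa [C, mul_apply] using congrFun (congrFun hAD i) j
    have h00 : (addRow A (Pi.single j 1) * C) 0 0 = D j j := by
      simp [C, mul_apply, Pi.single_apply]
    have h1 (i l) : (addRow A (Pi.single j 1) * C) (Fin.succ i) (Fin.succ l) =
        (s • (1 : Matrix (Fin k) (Fin k) S)) i l := by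
      simpa [C, mul_apply] using congrFun (congrFun h i) l
    have hdet : (addRow A (Pi.single j 1) * C).det = D j j * s ^ k := by
      rw [det_of_isUpperTriangular, Fin.prod_univ_succ, h00]
      · simp [h1]
      · intro i l hil
        induction l using Fin.cases with
        | zero =>
          induction i using Fin.cases with
          | zero => exact absurd hil (lt_irrefl _)
          | succ i => exact h0 i
        | succ l =>
          induction i using Fin.cases with
          | zero => exact absurd hil (by simp)
          | succ i =>
            rw [h1, Matrix.smul_apply, one_apply_ne, smul_zero]
            rintro rfl
            exact absurd hil (lt_irrefl _)
    rw [← hdet, det_mul, det_addRow]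
    simpa using Ideal.mul_mem_right _ _ (Ideal.subset_span (Set.mem_range_self j))
  have hsum : s ^ (k + 1) = ∑ j, D j j * s ^ k := by
    rw [← Finset.sum_mul, pow_succ', ← htr]
    rfl
  rw [hsum]
  exact Ideal.sum_mem _ fun j _ ↦ hmem j

lemma exists_eq_dotProduct_of_mem_span {ι : Type*} [Fintype ι] {v : ι → S} {a : S}
    (ha : a ∈ Ideal.span (Set.range v)) : ∃ c : ι → S, a = c ⬝ᵥ v := by
  obtain ⟨c, hc⟩ := (Submodule.mem_span_range_iff_exists_fun S).mp ha
  exact ⟨c, hc.symm⟩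

/-- If the ideal of maximal minors contains a weakly regular sequence of length two, then the
kernel of the matrix is freely generated by the vector of maximal minors. -/
theorem ker_eq_span_maxMinors (A : Matrix (Fin k) (Fin (k + 1)) S) {a b : S}
    (ha : a ∈ Ideal.span (Set.range (maxMinors A)))
    (hb : b ∈ Ideal.span (Set.range (maxMinors A)))
    (hreg : ∀ z, a * z = 0 → z = 0) (hreg' : ∀ z t, b * z = a * t → ∃ w, z = a * w) :
    (∀ r : S, r • maxMinors A = 0 → r = 0) ∧ ∀ w, A *ᵥ w = 0 → ∃ r : S, w = r • maxMinors A := by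
  obtain ⟨c, hc⟩ := exists_eq_dotProduct_of_mem_span ha
  obtain ⟨d, hd⟩ := exists_eq_dotProduct_of_mem_span hb
  refine ⟨fun r hr ↦ hreg r ?_, fun w hw ↦ ?_⟩
  · rw [hc, mul_comm, ← smul_eq_mul, ← dotProduct_smul, hr, dotProduct_zero]
  · have hcw := det_addRow_smul A c hw
    rw [det_addRow, ← hc] at hcw
    have hdw := congrArg (d ⬝ᵥ ·) hcw
    simp only [dotProduct_smul, ← hd, smul_eq_mul] at hdw
    obtain ⟨r, hr⟩ := hreg' (c ⬝ᵥ w) (d ⬝ᵥ w) (by rw [hdw, mul_comm])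
    refine ⟨r, ?_⟩
    rw [← sub_eq_zero]
    ext i
    refine hreg _ ?_
    have := congrFun hcw i
    simp only [Pi.smul_apply, smul_eq_mul, hr, Pi.sub_apply] at this ⊢
    linear_combination this

end Minors

lemma rankAtStalk_add_one_of_exact {Q K F P : Type*} [CommRing Q] [AddCommGroup K]
    [AddCommGroup F] [AddCommGroup P] [Module Q K] [Module Q F] [Module Q P] [Module.Flat Q K]
    [Module.Finite Q K] {i : K →ₗ[Q] F} {g : F →ₗ[Q] P} (hi : Function.Injective i)
    (hg : Function.Surjective g) (hig : Function.Exact i g) (e : P ≃ₗ[Q] Q)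
    (q : PrimeSpectrum Q) : Module.rankAtStalk F q = Module.rankAtStalk K q + 1 := by
  have : Nontrivial Q := q.nontrivial
  have : Module.Free Q P := .of_equiv e.symm
  have : Module.Finite Q P := .equiv e.symm
  obtain ⟨l, hl⟩ := LinearMap.exists_rightInverse_of_surjective g (LinearMap.range_eq_top.mpr hg)
  rw [Module.rankAtStalk_eq_of_equiv (hig.splitSurjectiveEquiv hi ⟨l, hl⟩).1,
    Module.rankAtStalk_prod, Module.rankAtStalk_eq_of_equiv e, Module.rankAtStalk_self]
  rfl

lemma exists_comap_localization_nonZeroDivisors_le {S : Type*} [CommRing S]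
    (p : PrimeSpectrum S) : ∃ q : PrimeSpectrum (Localization (nonZeroDivisors S)),
      PrimeSpectrum.comap (algebraMap S (Localization (nonZeroDivisors S))) q ≤ p := by
  obtain ⟨p₀, hp₀, hle⟩ := Ideal.exists_minimalPrimes_le (I := ⊥) (J := p.asIdeal) bot_le
  have hdisj := (Ideal.disjoint_nonZeroDivisors_of_mem_minimalPrimes hp₀).symm
  have hp₀' : p₀.IsPrime := hp₀.1.1
  exact ⟨⟨_, IsLocalization.isPrime_of_isPrime_disjoint _
    (Localization (nonZeroDivisors S)) p₀ hp₀' hdisj⟩,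
    (IsLocalization.under_map_of_isPrime_disjoint _ _ hp₀' hdisj).trans_le hle⟩

/-- A finite flat submodule of a finite free module has constant rank if the quotient has
generic rank one. -/
lemma rankAtStalk_add_one_of_genericRankOne {S K M : Type} [CommRing S] [AddCommGroup K]
    [Module S K] [Module.Flat S K] [Module.Finite S K] [AddCommGroup M] [Module S M] {n : ℕ}
    {i : K →ₗ[S] Fin n → S} {φ : (Fin n → S) →ₗ[S] M} (hi : Function.Injective i)
    (hφ : Function.Surjective φ) (hiφ : Function.Exact i φ) (hrk : GenericRankOne S M)
    (p : PrimeSpectrum S) : Module.rankAtStalk K p + 1 = n := by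
  have : Nontrivial S := p.nontrivial
  obtain ⟨e⟩ := hrk
  obtain ⟨q, hq⟩ := exists_comap_localization_nonZeroDivisors_le p
  have hK := Module.rankAtStalk_isBaseChange
    (LocalizedModule.isBaseChange (nonZeroDivisors S) K) q
  have hF := Module.rankAtStalk_isBaseChange
    (LocalizedModule.isBaseChange (nonZeroDivisors S) (Fin n → S)) q
  rw [Module.rankAtStalk_eq_of_le_of_finite_of_flat _ hq] at hK hF
  have hE := rankAtStalk_add_one_of_exact
    (LocalizedModule.map_injective (nonZeroDivisors S) _ hi)
    (LocalizedModule.map_surjective (nonZeroDivisors S) φ hφ)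
    (LocalizedModule.map_exact (nonZeroDivisors S) _ _ hiφ) e q
  rw [hK, hF, Module.rankAtStalk_eq_finrank_of_free] at hE
  simpa using hE.symm

lemma exists_basis_of_genericRankOne {S K M : Type} [CommRing S] [Finite (MaximalSpectrum S)]
    [Nontrivial S] [AddCommGroup K] [Module S K] [Module.Flat S K] [Module.Finite S K]
    [AddCommGroup M] [Module S M] {n : ℕ} {i : K →ₗ[S] Fin n → S} {φ : (Fin n → S) →ₗ[S] M}
    (hi : Function.Injective i) (hφ : Function.Surjective φ) (hiφ : Function.Exact i φ)
    (hrk : GenericRankOne S M) : ∃ k, n = k + 1 ∧ Nonempty (Module.Basis (Fin k) S K) := by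
  obtain ⟨m, hm⟩ := Ideal.exists_maximal S
  refine ⟨n - 1, ?_, Module.nonempty_basis_of_flat_of_finrank_eq S _ _ fun P ↦ ?_⟩
  · have := rankAtStalk_add_one_of_genericRankOne hi hφ hiφ hrk ⟨m, hm.isPrime⟩
    lia
  · have hP := P.isMaximal
    let : Field (S ⧸ P.asIdeal) := Ideal.Quotient.field _
    let q : PrimeSpectrum (S ⧸ P.asIdeal) := ⟨⊥, Ideal.isPrime_bot⟩
    have hq : PrimeSpectrum.comap (algebraMap S (S ⧸ P.asIdeal)) q = ⟨_, hP.isPrime⟩ :=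
      PrimeSpectrum.ext (Ideal.mk_ker (I := P.asIdeal))
    have h1 := Module.rankAtStalk_baseChange (R := S) (M := K) q
    rw [hq, Module.rankAtStalk_eq_finrank_of_free] at h1
    have h2 := rankAtStalk_add_one_of_genericRankOne hi hφ hiφ hrk ⟨_, hP.isPrime⟩
    rw [← h1] at h2
    simp at h2
    lia

lemma finite_maximalSpectrum_of_isLocalRing (A S : Type*) [CommRing A] [IsLocalRing A]
    [CommRing S] [Algebra A S] [Module.Finite A S] : Finite (MaximalSpectrum S) := by
  have := Algebra.QuasiFinite.finite_primesOver (S := S) (IsLocalRing.maximalIdeal A)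
  have := this.to_subtype
  refine Finite.of_injective
    (β := (IsLocalRing.maximalIdeal A).primesOver S) (fun P ↦ ⟨P.asIdeal, ?_⟩) ?_
  · have := P.isMaximal
    exact ⟨this.isPrime, ⟨(IsLocalRing.eq_maximalIdeal
      (Ideal.isMaximal_comap_of_isIntegral_of_isMaximal P.asIdeal)).symm⟩⟩
  · intro P P' h
    exact MaximalSpectrum.ext (congrArg Subtype.val h)

section ExtComputation

open CategoryTheory Limits

universe u

lemma CochainComplex.exists_surjective_homology {R : Type u} [CommRing R]
    (K : CochainComplex (ModuleCat.{u} R) ℕ) (n : ℕ) (hd : K.d (n + 1) (n + 2) = 0)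
    {Z : ModuleCat.{u} R} (E : Z ≅ K.homology (n + 1)) :
    ∃ ψ : K.X (n + 1) →ₗ[R] Z, Function.Surjective ψ ∧
      ∀ x, ψ x = 0 ↔ ∃ y, (K.d n (n + 1)).hom y = x := by
  let e : K.opcycles (n + 1) ≅ Z :=
    (E ≪≫ K.isoHomologyι (n + 1) (n + 2) (by simp) hd).symm
  have hrange (j) (hj : (ComplexShape.up ℕ).prev (n + 1) = j) (x) :
      (K.pOpcycles (n + 1)).hom x = 0 ↔ ∃ y, (K.d j (n + 1)).hom y = x := by
    subst hj
    exact (K.sc (n + 1)).moduleCat_pOpcycles_eq_zero_iff x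
  refine ⟨e.hom.hom ∘ₗ (K.pOpcycles (n + 1)).hom, ?_, fun x ↦ ?_⟩
  · exact ((ModuleCat.epi_iff_surjective e.hom).mp inferInstance).comp
      ((ModuleCat.epi_iff_surjective _).mp inferInstance)
  · rw [← hrange n (by simp), LinearMap.comp_apply]
    exact map_eq_zero_iff e.hom.hom ((ModuleCat.mono_iff_injective e.hom).mp inferInstance)

/-- If a projective resolution vanishes in degree `n + 2`, then `Ext` in degree `n + 1` is the
cokernel of precomposition with the differential. -/
lemma exists_surjective_ext {R : Type u} [CommRing R] {X : ModuleCat.{u} R}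
    (P : ProjectiveResolution X) (Y : ModuleCat.{u} R) (n : ℕ)
    (h : IsZero (P.complex.X (n + 2))) :
    ∃ ψ : (P.complex.X (n + 1) ⟶ Y) →ₗ[R]
        ((_root_.Ext R (ModuleCat R) (n + 1)).obj (Opposite.op X)).obj Y,
      Function.Surjective ψ ∧
        ∀ f, ψ f = 0 ↔ ∃ g : P.complex.X n ⟶ Y, P.complex.d (n + 1) n ≫ g = f :=
  CochainComplex.exists_surjective_homology (P.complex.linearYonedaObj R Y) n
    (by ext f; exact h.eq_of_src _ _) (P.isoExt (n + 1) Y)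

section Resolution

variable {R : Type u} [CommRing R] {P₀ P₁ P₂ M : ModuleCat.{u} R}

/-- The objects of the chain complex `⋯ ⟶ 0 ⟶ P₂ ⟶ P₁ ⟶ P₀`. -/
def threeTermX (P₀ P₁ P₂ : ModuleCat.{u} R) : ℕ → ModuleCat.{u} R
  | 0 => P₀
  | 1 => P₁
  | 2 => P₂
  | _ + 3 => ModuleCat.of R PUnit

/-- The differentials of the chain complex `⋯ ⟶ 0 ⟶ P₂ ⟶ P₁ ⟶ P₀`. -/
def threeTermD (f : P₂ ⟶ P₁) (g : P₁ ⟶ P₀) :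
    ∀ n, threeTermX P₀ P₁ P₂ (n + 1) ⟶ threeTermX P₀ P₁ P₂ n
  | 0 => g
  | 1 => f
  | _ + 2 => 0

/-- The chain complex `⋯ ⟶ 0 ⟶ P₂ ⟶ P₁ ⟶ P₀`. -/
def threeTermComplex (f : P₂ ⟶ P₁) (g : P₁ ⟶ P₀) (hfg : f ≫ g = 0) :
    ChainComplex (ModuleCat.{u} R) ℕ :=
  ChainComplex.of (threeTermX P₀ P₁ P₂) (threeTermD f g)
    (fun | 0 => hfg | 1 => zero_comp | _ + 2 => zero_comp)

variable {f : P₂ ⟶ P₁} {g : P₁ ⟶ P₀} {π : P₀ ⟶ M}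

lemma threeTermComplex_d_one (hfg : f ≫ g = 0) : (threeTermComplex f g hfg).d 1 0 = g :=
  ChainComplex.of_d (threeTermX P₀ P₁ P₂) (threeTermD f g) 0

lemma threeTermComplex_d_two (hfg : f ≫ g = 0) : (threeTermComplex f g hfg).d 2 1 = f :=
  ChainComplex.of_d (threeTermX P₀ P₁ P₂) (threeTermD f g) 1

lemma threeTermComplex_isZero (hfg : f ≫ g = 0) (n : ℕ) :
    IsZero ((threeTermComplex f g hfg).X (n + 3)) :=
  ModuleCat.isZero_of_subsingleton (ModuleCat.of R PUnit)

lemma threeTermComplex_exactAt_succ (hf : Function.Injective f) (hfg : Function.Exact f g)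
    (h : f ≫ g = 0) (n : ℕ) : (threeTermComplex f g h).ExactAt (n + 1) := by
  rw [HomologicalComplex.exactAt_iff' _ (n + 1 + 1) (n + 1) n (by simp) (by simp)]
  match n with
  | 0 =>
    rw [ShortComplex.ShortExact.moduleCat_exact_iff_function_exact]
    change Function.Exact ((threeTermComplex f g h).d 2 1) ((threeTermComplex f g h).d 1 0)
    rw [threeTermComplex_d_one, threeTermComplex_d_two]
    exact hfg
  | 1 =>
    rw [ShortComplex.moduleCat_exact_iff]
    intro x hx
    change ((threeTermComplex f g h).d 2 1) x = 0 at hx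
    rw [threeTermComplex_d_two] at hx
    exact ⟨0, (map_zero _).trans (hf (hx.trans (map_zero f.hom).symm)).symm⟩
  | n + 2 => exact ShortComplex.exact_of_isZero_X₂ _ (threeTermComplex_isZero h n)

/-- The projective resolution of length two attached to an exact sequence. -/
def threeTermResolution [Projective P₀] [Projective P₁] [Projective P₂]
    (hf : Function.Injective f) (hfg : Function.Exact f g) (hgπ : Function.Exact g π)
    (hπ : Function.Surjective π) (h : f ≫ g = 0) (h' : g ≫ π = 0) : ProjectiveResolution M where
  complex := threeTermComplex f g h
  projective
    | 0 => inferInstanceAs (Projective P₀)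
    | 1 => inferInstanceAs (Projective P₁)
    | 2 => inferInstanceAs (Projective P₂)
    | n + 3 => (threeTermComplex_isZero h n).projective
  π := (ChainComplex.toSingle₀Equiv (threeTermComplex f g h) M).symm
    ⟨π, (congrArg (· ≫ π) (threeTermComplex_d_one h)).trans h'⟩
  quasiIso := ⟨fun n ↦ by
    cases n with
    | zero =>
      rw [ChainComplex.quasiIsoAt₀_iff, ShortComplex.quasiIso_iff_of_zeros' _ rfl rfl rfl]
      refine (ShortComplex.exact_and_epi_g_iff_of_iso
        (S₂ := ShortComplex.mk g π h') ?_).2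
        ⟨?_, ?_⟩
      · refine ShortComplex.isoMk (Iso.refl P₁) (Iso.refl P₀) (Iso.refl M) ?_ ?_
        · exact (Category.id_comp g).trans
            ((threeTermComplex_d_one h).symm.trans (Category.comp_id _).symm)
        · refine (Category.id_comp π).trans (Eq.trans ?_ (Category.comp_id _).symm)
          exact (ChainComplex.toSingle₀Equiv_symm_apply_f_zero
            (C := threeTermComplex f g h) π _).symm
      · rwa [ShortComplex.ShortExact.moduleCat_exact_iff_function_exact]
      · rwa [ModuleCat.epi_iff_surjective]
    | succ n =>
      rw [quasiIsoAt_iff_exactAt']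
      · exact threeTermComplex_exactAt_succ hf hfg h n
      · exact ChainComplex.exactAt_succ_single_obj _ _⟩

end Resolution

variable {R : Type u} [CommRing R] {P₀ P₁ P₂ M : Type u} [AddCommGroup P₀] [AddCommGroup P₁]
  [AddCommGroup P₂] [AddCommGroup M] [Module R P₀] [Module R P₁] [Module R P₂] [Module R M]
  [Module.Projective R P₀] [Module.Projective R P₁]

lemma exists_surjective_ext_two [Module.Projective R P₂] {f : P₂ →ₗ[R] P₁} {g : P₁ →ₗ[R] P₀}
    {π : P₀ →ₗ[R] M} (hf : Function.Injective f) (hfg : Function.Exact f g)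
    (hgπ : Function.Exact g π) (hπ : Function.Surjective π) (Y : ModuleCat.{u} R) :
    ∃ ψ : (P₂ →ₗ[R] Y) →ₗ[R]
        ((_root_.Ext R (ModuleCat R) 2).obj (Opposite.op (ModuleCat.of R M))).obj Y,
      Function.Surjective ψ := by
  obtain ⟨ψ, hψ, -⟩ := exists_surjective_ext (threeTermResolution (f := ModuleCat.ofHom f)
    (g := ModuleCat.ofHom g) (π := ModuleCat.ofHom π) hf hfg hgπ hπ
    (ModuleCat.hom_ext hfg.linearMap_comp_eq_zero) (ModuleCat.hom_ext hgπ.linearMap_comp_eq_zero))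
    Y 1 (ModuleCat.isZero_of_subsingleton (ModuleCat.of R PUnit))
  let ψ' : (ModuleCat.of R P₂ ⟶ Y) →ₗ[R]
    ((_root_.Ext R (ModuleCat R) 2).obj (Opposite.op (ModuleCat.of R M))).obj Y := ψ
  have hψ' : Function.Surjective ψ' := hψ
  refine ⟨ψ' ∘ₗ
    (ModuleCat.homLinearEquiv (S := R) (M := ModuleCat.of R P₂) (N := Y)).symm.toLinearMap,
    ?_⟩
  rw [LinearMap.coe_comp]
  exact hψ'.comp (LinearEquiv.surjective _)

lemma exists_surjective_ext_one_s7 {g : P₁ →ₗ[R] P₀} {π : P₀ →ₗ[R] M}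
    (hg : Function.Injective g) (hgπ : Function.Exact g π)
    (hπ : Function.Surjective π) (Y : ModuleCat.{u} R) :
    ∃ ψ : (P₁ →ₗ[R] Y) →ₗ[R]
        ((_root_.Ext R (ModuleCat R) 1).obj (Opposite.op (ModuleCat.of R M))).obj Y,
      Function.Surjective ψ ∧ ∀ f, ψ f = 0 ↔ ∃ h : P₀ →ₗ[R] Y, h ∘ₗ g = f := by
  have hfg : Function.Exact (0 : PUnit.{u + 1} →ₗ[R] P₁) g := by
    rw [← LinearMap.ker_eq_bot] at hg
    rw [LinearMap.exact_iff, hg, LinearMap.range_zero]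
  obtain ⟨ψ, hψ, hψ₀⟩ := exists_surjective_ext (threeTermResolution
    (f := ModuleCat.ofHom (0 : PUnit.{u + 1} →ₗ[R] P₁))
    (g := ModuleCat.ofHom g) (π := ModuleCat.ofHom π) (Function.injective_of_subsingleton _)
    hfg hgπ hπ
    (ModuleCat.hom_ext hfg.linearMap_comp_eq_zero) (ModuleCat.hom_ext hgπ.linearMap_comp_eq_zero))
    Y 0 (ModuleCat.isZero_of_subsingleton (ModuleCat.of R PUnit))
  let ψ' : (ModuleCat.of R P₁ ⟶ Y) →ₗ[R]
    ((_root_.Ext R (ModuleCat R) 1).obj (Opposite.op (ModuleCat.of R M))).obj Y := ψ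
  have hψ' : Function.Surjective ψ' := hψ
  refine ⟨ψ' ∘ₗ
    (ModuleCat.homLinearEquiv (S := R) (M := ModuleCat.of R P₁) (N := Y)).symm.toLinearMap,
    ?_, fun f ↦ (hψ₀ (ModuleCat.ofHom f)).trans ?_⟩
  · rw [LinearMap.coe_comp]
    exact hψ'.comp (LinearEquiv.surjective _)
  have hd := threeTermComplex_d_one (f := ModuleCat.ofHom (0 : PUnit.{u + 1} →ₗ[R] P₁))
    (g := ModuleCat.ofHom g) (ModuleCat.hom_ext hfg.linearMap_comp_eq_zero)
  constructor
  · rintro ⟨h, hh⟩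
    exact ⟨h.hom, congrArg ModuleCat.Hom.hom ((congrArg (· ≫ h) hd.symm).trans hh)⟩
  · rintro ⟨h, hh⟩
    exact ⟨ModuleCat.ofHom h,
      (congrArg (· ≫ ModuleCat.ofHom h) hd).trans (ModuleCat.hom_ext hh)⟩

end ExtComputation

section Assembly

open Matrix

lemma exists_exact_mulVecLin_ext_one {S M : Type} [CommRing S] [AddCommGroup M] [Module S M]
    {m n : ℕ} {φ : (Fin n → S) →ₗ[S] M} (hφ : Function.Surjective φ)
    (b : Module.Basis (Fin m) S (LinearMap.ker φ)) :
    ∃ (A : Matrix (Fin m) (Fin n) S) (ψ : (Fin m → S) →ₗ[S] ↥(ExtGrp S M 1)),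
      Function.Surjective ψ ∧ Function.Exact A.mulVecLin ψ := by
  let g : (Fin m → S) →ₗ[S] Fin n → S := (LinearMap.ker φ).subtype ∘ₗ b.equivFun.symm.toLinearMap
  have hg : Function.Injective g :=
    (LinearMap.ker φ).injective_subtype.comp b.equivFun.symm.injective
  have hgφ : Function.Exact g φ := by
    rw [LinearMap.exact_iff, LinearMap.range_comp, LinearEquiv.range, Submodule.map_top,
      Submodule.range_subtype]
  obtain ⟨ψ, hψ, hψ₀⟩ := exists_surjective_ext_one_s7 hg hgφ hφ (ModuleCat.of S S)
  let A : Matrix (Fin m) (Fin n) S := Matrix.of fun i ↦ (b i : Fin n → S)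
  have hA (i : Fin m) : g (Pi.single i 1) = A i :=
    (by simp [g] : g (Pi.single i 1) = b i)
  refine ⟨A, ψ ∘ₗ (dotProductEquiv S (Fin m)).toLinearMap, ?_, fun v ↦ (hψ₀ _).trans ?_⟩
  · rw [LinearMap.coe_comp]
    exact hψ.comp (LinearEquiv.surjective _)
  · refine (dotProductEquiv S (Fin n)).surjective.exists.trans (exists_congr fun w ↦ ?_)
    have hiff (i) : (dotProductEquiv S (Fin n) w ∘ₗ g) (Pi.single i 1) =
        dotProductEquiv S (Fin m) v (Pi.single i 1) ↔ A.mulVecLin w i = v i := by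
      simp [hA, mulVec, dotProduct_comm]
    exact ⟨fun h ↦ funext fun i ↦ (hiff i).mp (LinearMap.congr_fun h _),
      fun h ↦ (Pi.basisFun S (Fin m)).ext fun i ↦ by simpa using (hiff i).mpr (congrFun h i)⟩

lemma exists_notMem_algebraMap_mem_span_maxMinors {A S N : Type} [CommRing A] [CommRing S]
    [Algebra A S] [AddCommGroup N] [Module S N] {k : ℕ} {X : Matrix (Fin k) (Fin (k + 1)) S}
    {ψ : (Fin k → S) →ₗ[S] N} (hX : Function.Exact X.mulVecLin ψ) {q : Ideal A} [q.IsPrime]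
    (hq : ∀ x : N, ∃ s : A, s ∉ q ∧ algebraMap A S s • x = 0) :
    ∃ s ∉ q, algebraMap A S s ∈ Ideal.span (Set.range (maxMinors X)) := by
  choose s hs hs₀ using fun i ↦ hq (ψ (Pi.single i 1))
  have hmem : ∏ i, s i ∉ q := fun h ↦ by
    obtain ⟨i, -, hi⟩ := (Ideal.IsPrime.prod_mem_iff (p := q)).mp h
    exact hs i hi
  have hker (i) : ∃ w, X *ᵥ w = algebraMap A S (∏ i, s i) • Pi.single i 1 := by
    refine (hX _).mp ?_
    rw [map_smul, ← Finset.prod_erase_mul _ _ (Finset.mem_univ i), map_mul, mul_smul, hs₀,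
      smul_zero]
  choose w hw using hker
  refine ⟨(∏ i, s i) ^ (k + 1), fun h ↦ hmem (Ideal.IsPrime.mem_of_pow_mem ‹_› _ h), ?_⟩
  rw [map_pow]
  refine pow_mem_span_maxMinors X (Matrix.of fun j i ↦ w i j) ?_
  ext i j
  have := congrFun (hw j) i
  simpa [Matrix.mul_apply, mulVec, dotProduct, Matrix.one_apply, Pi.single_apply] using this

lemma exists_ext_two_eq_smul {S N : Type} [CommRing S] [AddCommGroup N] [Module S N] {k : ℕ}
    {X : Matrix (Fin k) (Fin (k + 1)) S} {ψ : (Fin k → S) →ₗ[S] N}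
    (hψ : Function.Surjective ψ) (hX : Function.Exact X.mulVecLin ψ)
    (hinj : ∀ r : S, r • maxMinors X = 0 → r = 0)
    (hker : ∀ w, X *ᵥ w = 0 → ∃ r : S, w = r • maxMinors X) :
    ∃ g : ↥(ExtGrp S N 2), ∀ x : ↥(ExtGrp S N 2), ∃ r : S, x = r • g := by
  obtain ⟨Ψ, hΨ⟩ := exists_surjective_ext_two (f := LinearMap.toSpanSingleton S _ (maxMinors X))
    ((injective_iff_map_eq_zero _).mpr hinj) (g := X.mulVecLin) (fun w ↦
      ⟨fun h ↦ (hker w h).imp fun r hr ↦ hr.symm, by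
        rintro ⟨r, rfl⟩
        simp [mulVec_maxMinors]⟩) hX hψ (ModuleCat.of S S)
  refine ⟨Ψ LinearMap.id, fun x ↦ ?_⟩
  obtain ⟨f, rfl⟩ := hΨ x
  refine ⟨f (1 : S), ?_⟩
  rw [← map_smul]
  congr 1
  exact LinearMap.ext_ring (by simp)

end Assembly

/-- Let `Λ` be a commutative Noetherian regular local ring and `𝓡` a commutative
`Λ`-algebra, free of finite rank as a `Λ`-module, with `Hom_Λ(𝓡, Λ) ≅ 𝓡` as
`𝓡`-modules.  Let `M` be a finitely generated `𝓡`-module with `pd_𝓡(M) ≤ 1` such that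
`N = Ext¹_𝓡(M, 𝓡)` is pseudo-null and `M` has generic rank one over `𝓡`.  Then
`E²(N) = Ext²_𝓡(N, 𝓡)` is a cyclic `𝓡`-module. -/
theorem ext_ext_cyclic
    (Λ 𝓡 : Type) [CommRing Λ] [IsNoetherianRing Λ] [IsLocalRing Λ]
    (hreg : IsRegularLocal Λ)
    [CommRing 𝓡] [Algebra Λ 𝓡] [Module.Free Λ 𝓡] [Module.Finite Λ 𝓡]
    (hdual : SelfDualAlgebra Λ 𝓡)
    (M : Type) [AddCommGroup M] [Module 𝓡 M] [Module.Finite 𝓡 M]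
    (hpd : ProjDimLEOne 𝓡 M)
    (hPN : IsPseudoNull Λ (𝓡 := 𝓡) ↥(ExtGrp 𝓡 M 1))
    (hrk : GenericRankOne 𝓡 M) :
    ∃ g : ↥(ExtGrp 𝓡 (↥(ExtGrp 𝓡 M 1)) 2),
      ∀ x : ↥(ExtGrp 𝓡 (↥(ExtGrp 𝓡 M 1)) 2), ∃ r : 𝓡, x = r • g := by
  cases subsingleton_or_nontrivial 𝓡
  · have := Module.subsingleton 𝓡 ↥(ExtGrp 𝓡 (↥(ExtGrp 𝓡 M 1)) 2)
    exact ⟨0, fun x ↦ ⟨0, Subsingleton.elim _ _⟩⟩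
  have := finite_maximalSpectrum_of_isLocalRing Λ 𝓡
  have : IsNoetherianRing 𝓡 := .of_finite Λ 𝓡
  obtain ⟨n, φ, hφ, _⟩ := hpd
  obtain ⟨k, rfl, ⟨b⟩⟩ := exists_basis_of_genericRankOne (LinearMap.ker φ).injective_subtype hφ
    φ.exact_subtype_ker_map hrk
  obtain ⟨A, ψ, hψ, hA⟩ := exists_exact_mulVecLin_ext_one hφ b
  obtain ⟨x, hx, y, hy, hreg₁, hreg₂⟩ := exists_weaklyRegular_pair hreg
    fun q hq hq' ↦ exists_notMem_algebraMap_mem_span_maxMinors hA (hPN q hq hq')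
  obtain ⟨hinj, hker⟩ := ker_eq_span_maxMinors A hx hy hreg₁ hreg₂
  exact exists_ext_two_eq_smul hψ hA hinj hker
end
end

section
/- Let Λ be a commutative Noetherian ring and let 𝓡 be a commutative Λ-algebra which is free of finite rank as a Λ-module and satisfies Hom_Λ(𝓡, Λ) ≅ 𝓡 as 𝓡-modules. Then for every 𝓡-module M (regarded as a Λ-module by restriction of scalars) and every i ≥ 0 there is a Λ-linear isomorphism Ext^i_𝓡(M, 𝓡) ≅ Ext^i_Λ(M, Λ). -/
noncomputable section

namespace SelfDualAlgebra

open CategoryTheory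

variable {Λ 𝓡 : Type} [CommRing Λ] [CommRing 𝓡] [Algebra Λ 𝓡]

/-- A projective module over a free `Λ`-algebra is projective over `Λ`. -/
lemma projective_of_free [Module.Free Λ 𝓡] (P : Type) [AddCommGroup P] [Module 𝓡 P] [Module Λ P]
    [IsScalarTower Λ 𝓡 P] [Module.Projective 𝓡 P] : Module.Projective Λ P := by
  obtain ⟨s, hs⟩ := Module.projective_def'.1 (inferInstance : Module.Projective 𝓡 P)
  refine Module.Projective.of_split (s.restrictScalars Λ)
    ((Finsupp.linearCombination 𝓡 (id : P → P)).restrictScalars Λ) ?_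
  ext p
  exact LinearMap.congr_fun hs p

/-- Restriction of scalars along a free algebra preserves projective modules. -/
lemma restrictScalars_preservesProjectiveObjects [Module.Free Λ 𝓡] :
    (ModuleCat.restrictScalars.{0} (algebraMap Λ 𝓡)).PreservesProjectiveObjects where
  projective_obj {P} hP := by
    have : Module.Projective 𝓡 P := (IsProjective.iff_projective (R := 𝓡) P).2 hP
    let _ : Module Λ P := Module.compHom P (algebraMap Λ 𝓡)
    have : IsScalarTower Λ 𝓡 P := ⟨fun a r p => by
      rw [Algebra.smul_def, mul_smul]; rfl⟩
    have := projective_of_free (Λ := Λ) (𝓡 := 𝓡) P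
    exact (IsProjective.iff_projective (R := Λ) P).1 this

/-- The adjunction isomorphism `Hom_𝓡(N, 𝓡) ≃ Hom_Λ(N, Λ)` attached to an isomorphism
`Hom_Λ(𝓡, Λ) ≃ 𝓡`. -/
def homEquiv (e : (𝓡 →ₗ[Λ] Λ) ≃ₗ[Λ] 𝓡)
    (he : ∀ (r : 𝓡) (φ : 𝓡 →ₗ[Λ] Λ), e (φ.comp (LinearMap.mulLeft Λ r)) = r * e φ)
    (N : Type) [AddCommGroup N] [Module 𝓡 N] [Module Λ N] [IsScalarTower Λ 𝓡 N] :
    (N →ₗ[𝓡] 𝓡) ≃ₗ[Λ] (N →ₗ[Λ] Λ) :=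
  have he' (r s : 𝓡) : e.symm (r * s) = (e.symm s).comp (LinearMap.mulLeft Λ r) := by
    rw [LinearEquiv.symm_apply_eq, he, e.apply_symm_apply]
  { toFun f := LinearMap.applyₗ (1 : 𝓡) ∘ₗ e.symm.toLinearMap ∘ₗ f.restrictScalars Λ
    map_add' f g := by ext; simp
    map_smul' a f := by ext; simp
    invFun g :=
      { toFun p := e (g ∘ₗ (LinearMap.toSpanSingleton 𝓡 N p).restrictScalars Λ)
        map_add' p q := by
          rw [← map_add]; congr 1; ext; simp
        map_smul' r p := by
          rw [RingHom.id_apply, smul_eq_mul, ← he]; congr 1; ext x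
          simp [← mul_smul, mul_comm x r] }
    left_inv f := by
      ext p
      simp only [LinearMap.coe_mk, AddHom.coe_mk]
      rw [← LinearEquiv.eq_symm_apply]
      ext x
      simp [he']
    right_inv g := by ext p; simp }

/-- The isomorphism `Hom_𝓡(N, 𝓡) ≅ Hom_Λ(N, Λ)` in the category of `Λ`-modules. -/
def homIso (e : (𝓡 →ₗ[Λ] Λ) ≃ₗ[Λ] 𝓡)
    (he : ∀ (r : 𝓡) (φ : 𝓡 →ₗ[Λ] Λ), e (φ.comp (LinearMap.mulLeft Λ r)) = r * e φ)
    (N : ModuleCat.{0} 𝓡) :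
    (ModuleCat.restrictScalars.{0} (algebraMap Λ 𝓡)).obj
        (ModuleCat.of 𝓡 (N ⟶ ModuleCat.of 𝓡 𝓡)) ≅
      ModuleCat.of Λ ((ModuleCat.restrictScalars.{0} (algebraMap Λ 𝓡)).obj N ⟶ ModuleCat.of Λ Λ) :=
  letI : Module Λ N := Module.compHom N (algebraMap Λ 𝓡)
  haveI : IsScalarTower Λ 𝓡 N := ⟨fun a r p => by rw [Algebra.smul_def, mul_smul]; rfl⟩
  let L : (ModuleCat.restrictScalars.{0} (algebraMap Λ 𝓡)).obj
        (ModuleCat.of 𝓡 (N ⟶ ModuleCat.of 𝓡 𝓡)) ≃ₗ[Λ]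
      ((ModuleCat.restrictScalars.{0} (algebraMap Λ 𝓡)).obj N ⟶ ModuleCat.of Λ Λ) :=
    { toFun f := ModuleCat.ofHom
        (X := (ModuleCat.restrictScalars.{0} (algebraMap Λ 𝓡)).obj N)
        (homEquiv e he N (ModuleCat.Hom.hom f))
      invFun g := ModuleCat.ofHom ((homEquiv e he N).symm g.hom)
      map_add' f g := by
        ext x
        exact LinearMap.congr_fun ((homEquiv e he N).map_add f.hom g.hom) x
      map_smul' a f := by
        have h : (ModuleCat.Hom.hom (algebraMap Λ 𝓡 a • f : N ⟶ ModuleCat.of 𝓡 𝓡)) =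
            a • ModuleCat.Hom.hom (f : N ⟶ ModuleCat.of 𝓡 𝓡) := by
          ext x
          exact (Algebra.smul_def a _).symm
        ext x
        exact LinearMap.congr_fun
          ((congrArg (homEquiv e he N) h).trans ((homEquiv e he N).map_smul a f.hom)) x
      left_inv f := ModuleCat.hom_ext ((homEquiv e he N).symm_apply_apply (ModuleCat.Hom.hom f))
      right_inv g := ModuleCat.hom_ext ((homEquiv e he N).apply_symm_apply g.hom) }
  L.toModuleIso

/-- For a chain complex `K` of `𝓡`-modules, `Hom_𝓡(K, 𝓡) ≅ Hom_Λ(K, Λ)` as complexes of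
`Λ`-modules. -/
def complexIso (e : (𝓡 →ₗ[Λ] Λ) ≃ₗ[Λ] 𝓡)
    (he : ∀ (r : 𝓡) (φ : 𝓡 →ₗ[Λ] Λ), e (φ.comp (LinearMap.mulLeft Λ r)) = r * e φ)
    (K : ChainComplex (ModuleCat.{0} 𝓡) ℕ) :
    ((ModuleCat.restrictScalars.{0} (algebraMap Λ 𝓡)).mapHomologicalComplex _).obj
        (K.linearYonedaObj 𝓡 (ModuleCat.of 𝓡 𝓡)) ≅
      ChainComplex.linearYonedaObj
        (((ModuleCat.restrictScalars.{0} (algebraMap Λ 𝓡)).mapHomologicalComplex _).obj K)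
        Λ (ModuleCat.of Λ Λ) :=
  HomologicalComplex.Hom.isoOfComponents (fun n => homIso e he (K.X n)) fun _ _ _ =>
    ModuleCat.hom_ext (LinearMap.ext fun _ => ModuleCat.hom_ext (LinearMap.ext fun _ => rfl))

/-- `Ext_𝓡(M, 𝓡)`, viewed over `Λ`, is isomorphic to `Ext_Λ(M, Λ)`. -/
lemma nonempty_extIso [Module.Free Λ 𝓡] (h : SelfDualAlgebra Λ 𝓡)
    (M : ModuleCat.{0} 𝓡) (i : ℕ) :
    Nonempty ((ModuleCat.restrictScalars.{0} (algebraMap Λ 𝓡)).obj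
        (((_root_.Ext 𝓡 (ModuleCat.{0} 𝓡) i).obj (Opposite.op M)).obj (ModuleCat.of 𝓡 𝓡)) ≅
      ((_root_.Ext Λ (ModuleCat.{0} Λ) i).obj (Opposite.op
        ((ModuleCat.restrictScalars.{0} (algebraMap Λ 𝓡)).obj M))).obj (ModuleCat.of Λ Λ)) := by
  obtain ⟨e, he⟩ := h
  have : (ModuleCat.restrictScalars.{0} (algebraMap Λ 𝓡)).PreservesProjectiveObjects :=
    restrictScalars_preservesProjectiveObjects
  let F := ModuleCat.restrictScalars.{0} (algebraMap Λ 𝓡)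
  let P := ProjectiveResolution.of M
  let C := P.complex.linearYonedaObj 𝓡 (ModuleCat.of 𝓡 𝓡)
  exact ⟨F.mapIso (P.isoExt i _) ≪≫ ((C.sc i).mapHomologyIso F).symm ≪≫
    (HomologicalComplex.homologyFunctor _ _ i).mapIso (complexIso e he P.complex) ≪≫
    ((F.mapProjectiveResolution P).isoExt i (ModuleCat.of Λ Λ)).symm⟩

end SelfDualAlgebra

/-- Let `Λ` be a commutative Noetherian ring and `𝓡` a commutative `Λ`-algebra, free of
finite rank as a `Λ`-module, with `Hom_Λ(𝓡, Λ) ≅ 𝓡` as `𝓡`-modules.  Then for every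
`𝓡`-module `M` (regarded as a `Λ`-module by restriction of scalars) and every `i ≥ 0`
there is a `Λ`-linear isomorphism `Ext^i_𝓡(M, 𝓡) ≅ Ext^i_Λ(M, Λ)`:  an additive
isomorphism `e` satisfying `e ((algebraMap Λ 𝓡 a) • x) = a • e x`. -/
theorem ext_over_algebra_iso_ext_over_base
    (Λ 𝓡 : Type) [CommRing Λ] [IsNoetherianRing Λ]
    [CommRing 𝓡] [Algebra Λ 𝓡] [Module.Free Λ 𝓡] [Module.Finite Λ 𝓡]
    (hdual : SelfDualAlgebra Λ 𝓡)
    (M : Type) [AddCommGroup M] [Module 𝓡 M] [Module Λ M] [IsScalarTower Λ 𝓡 M]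
    (i : ℕ) :
    ∃ e : ↥(ExtGrp 𝓡 M i) ≃+ ↥(ExtGrp Λ M i),
      ∀ (a : Λ) (x : ↥(ExtGrp 𝓡 M i)),
        e (algebraMap Λ 𝓡 a • x) = a • e x := by
  obtain ⟨α⟩ := hdual.nonempty_extIso (ModuleCat.of 𝓡 M) i
  let L : (ModuleCat.restrictScalars.{0} (algebraMap Λ 𝓡)).obj (ModuleCat.of 𝓡 M) ≃ₗ[Λ] M :=
    { AddEquiv.refl M with map_smul' := fun a x => algebraMap_smul 𝓡 a (id x : M) }
  let β : (ModuleCat.restrictScalars.{0} (algebraMap Λ 𝓡)).obj (ModuleCat.of 𝓡 M) ≅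
      ModuleCat.of Λ M := L.toModuleIso
  let γ := (α ≪≫ (((Ext Λ (ModuleCat Λ) i).mapIso β.symm.op).app
    (ModuleCat.of Λ Λ))).toLinearEquiv
  exact ⟨γ.toAddEquiv, fun a x => γ.map_smul a x⟩
end
end
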